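/- Boundedness of the coefficients in the duplication equation (Lemma A.10). Under the random features setup and the data, activation, and scaling assumptions with n = 2: there exist constants c, C, ε₀ > 0 and D such that for all d ≥ D, with probability at least 1 − 2 exp(−c log² d) over V and the data (x_1, x_2), the following holds simultaneously for all real numbers a_1, a_2 and all ε_1, ε_2 ∈ ℝ^d satisfying ‖x_1 + ε_1‖_2 = ‖x_1 + ε_2‖_2 = √d, max(‖ε_1‖_2, ‖ε_2‖_2) ≤ ε₀ √d, and φ(x_2) = a_1 φ(x_1 + ε_1) + a_2 φ(x_1 + ε_2): |a_2| · δ ≤ C and |a_1 + a_2| ≤ C, where δ := ‖ε_2 − ε_1‖_2 / √d. -/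

import Mathlib

open MeasureTheory ProbabilityTheory Filter

noncomputable section

/-- Euclidean (ℓ²) norm of a vector in `Fin m → ℝ`. -/
def eNorm {m : ℕ} (x : Fin m → ℝ) : ℝ := Real.sqrt (∑ j, (x j) ^ 2)

/-- Euclidean dot product. -/
def dotp {m : ℕ} (u v : Fin m → ℝ) : ℝ := ∑ j, u j * v j

/-- The random-features map `x ↦ (φ(vₖᵀx))ₖ`, where `vₖ` is the `k`-th row of `V`. -/
def featureMap {p d : ℕ} (φ : ℝ → ℝ) (V : Fin p → Fin d → ℝ) (x : Fin d → ℝ) :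
    Fin p → ℝ := fun k => φ (dotp (V k) x)

/-- The `l`-th normalized probabilists' Hermite polynomial (orthonormal in `L²(N(0,1))`). -/
def hermiteFn (l : ℕ) (x : ℝ) : ℝ :=
  (Polynomial.aeval x (Polynomial.hermite l)) / Real.sqrt (Nat.factorial l)

/-- The `l`-th Hermite coefficient `μ_l` of `φ`. -/
def hermiteCoeff (φ : ℝ → ℝ) (l : ℕ) : ℝ :=
  ∫ g, φ g * hermiteFn l g ∂(gaussianReal 0 1)

/-- The nonlinear part of the feature map: `φ̃(x) = (φ(vₖᵀx) − μ₁ vₖᵀx)ₖ`. -/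
def tfeatureMap {p d : ℕ} (φ : ℝ → ℝ) (V : Fin p → Fin d → ℝ) (x : Fin d → ℝ) :
    Fin p → ℝ := fun k => φ (dotp (V k) x) - hermiteCoeff φ 1 * dotp (V k) x

/-- `μ̃² := Σ_{l ≥ 3} μ_l²`. -/
def tmu2 (φ : ℝ → ℝ) : ℝ := ∑' l : ℕ, if 3 ≤ l then (hermiteCoeff φ l) ^ 2 else 0

/-- The law of the random features matrix: i.i.d. entries `N(0, 1/d)`. -/
def gaussianMatrix (p d : ℕ) : Measure (Fin p → Fin d → ℝ) :=
  Measure.pi fun _ => Measure.pi fun _ => gaussianReal 0 ((d : NNReal))⁻¹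

/-- Sub-Gaussian norm of a distribution on `ℝ^d`:
`sup_{‖u‖₂ = 1} inf { t > 0 : E exp((uᵀx)²/t²) ≤ 2 }`. -/
def vecSubGNorm {d : ℕ} (P : Measure (Fin d → ℝ)) : ℝ :=
  ⨆ u : {u : Fin d → ℝ // eNorm u = 1},
    sInf {t : ℝ | 0 < t ∧ ∫ x, Real.exp ((dotp u.1 x) ^ 2 / t ^ 2) ∂P ≤ 2}

/-- Data assumption: `P` is a probability distribution on `ℝ^d` with `‖x‖₂ = √d` a.s.
and sub-Gaussian norm at most `K`. -/
structure DataAssumption {d : ℕ} (P : Measure (Fin d → ℝ)) (K : ℝ) : Prop where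
  prob : IsProbabilityMeasure P
  norm_eq : ∀ᵐ x ∂P, eNorm x = Real.sqrt d
  subg : vecSubGNorm P ≤ K

/-- Core activation assumption: `φ` is non-linear, Lipschitz, with Lipschitz derivative,
`μ₀ = μ₂ = 0` and `μ₁ ≠ 0`. -/
structure ActivationAssumptionCore (φ : ℝ → ℝ) : Prop where
  nonlinear : ¬ ∃ a b : ℝ, ∀ z, φ z = a * z + b
  lipschitz : ∃ L : NNReal, LipschitzWith L φ
  differentiable : Differentiable ℝ φ
  deriv_lipschitz : ∃ L' : NNReal, LipschitzWith L' (deriv φ)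
  mu0 : hermiteCoeff φ 0 = 0
  mu2 : hermiteCoeff φ 2 = 0
  mu1 : hermiteCoeff φ 1 ≠ 0

/-- Full activation assumption: additionally, there are two non-zero Hermite coefficients
of order ≥ 3 with different parity. -/
structure ActivationAssumption (φ : ℝ → ℝ) extends ActivationAssumptionCore φ : Prop where
  parity : ∃ l l' : ℕ, 3 ≤ l ∧ 3 ≤ l' ∧ l % 2 ≠ l' % 2 ∧
    hermiteCoeff φ l ≠ 0 ∧ hermiteCoeff φ l' ≠ 0

/-- Law of one row. -/
abbrev rowLaw (d : ℕ) : Measure (Fin d → ℝ) :=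
  Measure.pi fun _ : Fin d => gaussianReal 0 ((d : NNReal))⁻¹

lemma dotp_measurable {d : ℕ} (x : Fin d → ℝ) : Measurable (fun v : Fin d → ℝ => dotp v x) := by
  unfold dotp; fun_prop

lemma dotp_add_right {d : ℕ} (v x y : Fin d → ℝ) : dotp v (x + y) = dotp v x + dotp v y := by
  simp [dotp, mul_add, Finset.sum_add_distrib]

lemma dotp_sub_right {d : ℕ} (v x y : Fin d → ℝ) : dotp v (x - y) = dotp v x - dotp v y := by
  simp [dotp, mul_sub, Finset.sum_sub_distrib]

lemma dotp_smul_right {d : ℕ} (c : ℝ) (v x : Fin d → ℝ) : dotp v (c • x) = c * dotp v x := by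
  simp only [dotp, Finset.mul_sum, Pi.smul_apply, smul_eq_mul]
  exact Finset.sum_congr rfl fun i _ => by ring

lemma dotp_comm {d : ℕ} (x y : Fin d → ℝ) : dotp x y = dotp y x := by
  simp [dotp, mul_comm]

lemma dotp_self_eq {d : ℕ} (x : Fin d → ℝ) : dotp x x = eNorm x ^ 2 := by
  unfold dotp eNorm
  rw [Real.sq_sqrt (Finset.sum_nonneg fun i _ => sq_nonneg _)]
  exact Finset.sum_congr rfl fun i _ => by ring

lemma dotp_self_of_sph {d : ℕ} {x : Fin d → ℝ} (hx : eNorm x = Real.sqrt d) : dotp x x = d := by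
  rw [dotp_self_eq, hx, Real.sq_sqrt (Nat.cast_nonneg d)]

lemma rowLaw_gauss (d : ℕ) : HasGaussianLaw (fun v : Fin d → ℝ => v) (rowLaw d) := by
  have h := iIndepFun.hasGaussianLaw (P := rowLaw d) (X := fun (i : Fin d) (v : Fin d → ℝ) => v i)
    (fun i => ?_) ?_
  · exact h
  · refine ⟨?_⟩
    have := (measurePreserving_eval (fun _ : Fin d => gaussianReal 0 ((d : NNReal))⁻¹) i).map_eq
    have h2 : (rowLaw d).map (fun v : Fin d → ℝ => v i) = gaussianReal 0 ((d : NNReal))⁻¹ := this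
    rw [h2]; infer_instance
  · exact iIndepFun_pi (X := fun (i : Fin d) (x : ℝ) => x) (fun i => by fun_prop)

/-- `dotp · x` as a continuous linear map -/
def dotL {d : ℕ} (x : Fin d → ℝ) : (Fin d → ℝ) →L[ℝ] ℝ :=
  ∑ i, (x i) • (ContinuousLinearMap.proj (R := ℝ) (φ := fun _ : Fin d => ℝ) i)

lemma dotL_apply {d : ℕ} (x v : Fin d → ℝ) : dotL x v = dotp v x := by
  simp [dotL, dotp, mul_comm]

lemma dotp_gauss {d : ℕ} (x : Fin d → ℝ) : HasGaussianLaw (fun v => dotp v x) (rowLaw d) := by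
  have := (rowLaw_gauss d).map_fun (dotL x)
  simpa only [dotL_apply] using this

lemma dotp_gauss2 {d : ℕ} (x y : Fin d → ℝ) :
    HasGaussianLaw (fun v => (dotp v x, dotp v y)) (rowLaw d) := by
  have := (rowLaw_gauss d).map_fun ((dotL x).prod (dotL y))
  simpa only [ContinuousLinearMap.prod_apply, dotL_apply] using this

lemma coord_law {d : ℕ} (i : Fin d) :
    (rowLaw d).map (fun v => v i) = gaussianReal 0 ((d : NNReal))⁻¹ :=
  (measurePreserving_eval (fun _ : Fin d => gaussianReal 0 ((d : NNReal))⁻¹) i).map_eq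

lemma coord_memLp {d : ℕ} (i : Fin d) : MemLp (fun v : Fin d → ℝ => v i) 2 (rowLaw d) := by
  have h := memLp_id_gaussianReal' (μ := 0) (v := ((d : NNReal))⁻¹) 2 (by simp)
  rw [← coord_law i] at h
  exact (memLp_map_measure_iff aestronglyMeasurable_id (f := fun v : Fin d → ℝ => v i) (measurable_pi_apply i).aemeasurable).1 h

lemma coord_mean {d : ℕ} (i : Fin d) : ∫ v, v i ∂(rowLaw d) = 0 := by
  have h := integral_id_gaussianReal (μ := 0) (v := ((d : NNReal))⁻¹)
  rw [← coord_law i, integral_map (measurable_pi_apply i).aemeasurable (by fun_prop)] at h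
  exact h

lemma coord_cov {d : ℕ} (i j : Fin d) :
    covariance (fun v : Fin d → ℝ => v i) (fun v => v j) (rowLaw d)
      = if i = j then (d : ℝ)⁻¹ else 0 := by
  split_ifs with h
  · subst h
    rw [covariance_self (measurable_pi_apply i).aemeasurable]
    have h := variance_fun_id_gaussianReal (μ := 0) (v := ((d : NNReal))⁻¹)
    rw [← coord_law i, variance_map (X := fun x : ℝ => x) (Y := fun v : Fin d → ℝ => v i) aemeasurable_id
      (measurable_pi_apply i).aemeasurable] at h
    rw [show (fun v : Fin d → ℝ => v i) = (fun x => x) ∘ (fun v : Fin d → ℝ => v i) from rfl, h]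
    simp
  · refine IndepFun.covariance_eq_zero ?_ (coord_memLp i) (coord_memLp j)
    exact (iIndepFun_pi (μ := fun _ : Fin d => gaussianReal 0 ((d : NNReal))⁻¹)
      (X := fun (i : Fin d) (x : ℝ) => x) (fun i => by fun_prop)).indepFun h

lemma dotp_memLp {d : ℕ} (x : Fin d → ℝ) : MemLp (fun v => dotp v x) 2 (rowLaw d) :=
  (dotp_gauss x).memLp_two

lemma dotp_integrable {d : ℕ} (x : Fin d → ℝ) : Integrable (fun v => dotp v x) (rowLaw d) :=
  (dotp_gauss x).integrable

lemma dotp_mean {d : ℕ} (x : Fin d → ℝ) : ∫ v, dotp v x ∂(rowLaw d) = 0 := by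
  unfold dotp
  rw [integral_finsetSum]
  · simp [integral_mul_const, coord_mean]
  · intro i _
    exact ((coord_memLp i).integrable (by norm_num)).mul_const _

lemma dotp_cov {d : ℕ} (x y : Fin d → ℝ) :
    covariance (fun v => dotp v x) (fun v => dotp v y) (rowLaw d) = dotp x y / d := by
  unfold dotp
  rw [covariance_fun_sum_fun_sum]
  · simp_rw [covariance_mul_const_left, covariance_mul_const_right, coord_cov]
    rw [Finset.sum_div]
    refine Finset.sum_congr rfl fun i _ => ?_
    simp only [ite_mul, zero_mul, Finset.sum_ite_eq, Finset.mem_univ, if_true]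
    ring
  · intro i; exact (coord_memLp i).mul_const _
  · intro i; exact (coord_memLp i).mul_const _

lemma dotp_sq_mean {d : ℕ} (x : Fin d → ℝ) :
    ∫ v, dotp v x ^ 2 ∂(rowLaw d) = dotp x x / d := by
  rw [← dotp_cov, covariance_eq_sub (dotp_memLp x) (dotp_memLp x), dotp_mean]
  simp [pow_two]

lemma dotp_law {d : ℕ} (hd : 0 < d) {x : Fin d → ℝ} (hx : eNorm x = Real.sqrt d) :
    (rowLaw d).map (fun v => dotp v x) = gaussianReal 0 1 := by
  rw [(dotp_gauss x).map_eq_gaussianReal, dotp_mean, ← covariance_self (by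
    exact (dotp_measurable x).aemeasurable), dotp_cov, dotp_self_of_sph hx,
    div_self (by positivity)]
  simp

lemma dotp_indep {d : ℕ} {x y : Fin d → ℝ} (h : dotp x y = 0) :
    IndepFun (fun v => dotp v x) (fun v => dotp v y) (rowLaw d) :=
  (dotp_gauss2 x y).indepFun_of_covariance_eq_zero (by rw [dotp_cov, h, zero_div])

lemma integral_dotp {d : ℕ} (hd : 0 < d) {x : Fin d → ℝ} (hx : eNorm x = Real.sqrt d)
    {f : ℝ → ℝ} (hf : Measurable f) :
    ∫ v, f (dotp v x) ∂(rowLaw d) = ∫ g, f g ∂(gaussianReal 0 1) := by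
  rw [← dotp_law hd hx, integral_map (dotp_measurable x).aemeasurable hf.aestronglyMeasurable]

lemma integrable_dotp {d : ℕ} (hd : 0 < d) {x : Fin d → ℝ} (hx : eNorm x = Real.sqrt d)
    {f : ℝ → ℝ} (hf : Integrable f (gaussianReal 0 1)) :
    Integrable (fun v => f (dotp v x)) (rowLaw d) := by
  rw [← dotp_law hd hx] at hf
  exact hf.comp_measurable (dotp_measurable x)

lemma integrable_gauss_iff (f : ℝ → ℝ) :
    Integrable f (gaussianReal 0 1) ↔ Integrable (fun x => gaussianPDFReal 0 1 x * f x) := by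
  rw [gaussianReal_of_var_ne_zero 0 one_ne_zero,
    integrable_withDensity_iff_integrable_smul' (measurable_gaussianPDF 0 1)
      (ae_of_all _ fun x => gaussianPDF_lt_top)]
  simp [toReal_gaussianPDF]

lemma integrable_gauss_pow (n : ℕ) : Integrable (fun g : ℝ => |g| ^ n) (gaussianReal 0 1) := by
  have h := memLp_id_gaussianReal' (μ := 0) (v := 1) n (by simp)
  have := h.integrable_norm_pow'
  simpa using this

lemma gpdf_eq (x : ℝ) : gaussianPDFReal 0 1 x
    = (Real.sqrt (2 * Real.pi))⁻¹ * Real.exp (-(x ^ 2 / 2)) := by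
  simp [gaussianPDFReal, neg_div]

lemma gpdf_deriv (x : ℝ) :
    HasDerivAt (gaussianPDFReal 0 1) (-(x * gaussianPDFReal 0 1 x)) x := by
  have : gaussianPDFReal 0 1 = fun x => (Real.sqrt (2 * Real.pi))⁻¹ * Real.exp (-(x ^ 2 / 2)) := by
    funext x; exact gpdf_eq x
  rw [this]
  have h : HasDerivAt (fun x : ℝ => -(x ^ 2 / 2)) (-x) x := by
    have := ((hasDerivAt_pow 2 x).div_const 2).neg
    refine this.congr_deriv ?_
    norm_num
  refine ((h.exp).const_mul ((Real.sqrt (2 * Real.pi))⁻¹)).congr_deriv ?_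
  ring

/-- the constant exponential moment -/
def Mexp : ℝ := ∫ g, Real.exp (g ^ 2 / 4) ∂(gaussianReal 0 1)

lemma integrable_expsq : Integrable (fun g : ℝ => Real.exp (g ^ 2 / 4)) (gaussianReal 0 1) := by
  rw [integrable_gauss_iff]
  have := (integrable_exp_neg_mul_sq (b := 1 / 4) (by norm_num)).const_mul
    ((Real.sqrt (2 * Real.pi))⁻¹)
  refine this.congr (ae_of_all _ fun x => ?_)
  simp only [gpdf_eq]
  rw [mul_assoc, ← Real.exp_add]
  congr 2
  ring

lemma Mexp_nonneg : 0 ≤ Mexp := integral_nonneg fun _ => (Real.exp_pos _).le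

lemma lip_abs_le {φ : ℝ → ℝ} {L : NNReal} (h : LipschitzWith L φ) (x : ℝ) :
    |φ x| ≤ |φ 0| + L * |x| := by
  have := h.dist_le_mul x 0
  rw [Real.dist_eq, Real.dist_eq, sub_zero] at this
  have h2 : |φ x| ≤ |φ 0| + |φ x - φ 0| := by
    calc |φ x| = |φ 0 + (φ x - φ 0)| := by ring_nf
      _ ≤ _ := abs_add_le _ _
  linarith

lemma deriv_abs_le {φ : ℝ → ℝ} {L : NNReal} (h : LipschitzWith L φ) (x : ℝ) :
    |deriv φ x| ≤ L := by
  simpa using norm_deriv_le_of_lipschitz h (x₀ := x)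

lemma hermiteCoeff_one (φ : ℝ → ℝ) :
    hermiteCoeff φ 1 = ∫ g, φ g * g ∂(gaussianReal 0 1) := by
  simp [hermiteCoeff, hermiteFn]

lemma hermiteCoeff_zero (φ : ℝ → ℝ) :
    hermiteCoeff φ 0 = ∫ g, φ g ∂(gaussianReal 0 1) := by
  simp [hermiteCoeff, hermiteFn]

lemma stein {φ : ℝ → ℝ} (hφ : ActivationAssumptionCore φ) :
    ∫ g, deriv φ g ∂(gaussianReal 0 1) = hermiteCoeff φ 1 := by
  obtain ⟨L, hL⟩ := hφ.lipschitz
  have hm : Measurable φ := hφ.differentiable.continuous.measurable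
  have i1 : Integrable (fun g => φ g * g) (gaussianReal 0 1) := by
    have hb := ((integrable_gauss_pow 1).const_mul |φ 0|).add
      ((integrable_gauss_pow 2).const_mul (L : ℝ))
    refine hb.mono' (by fun_prop) (ae_of_all _ fun x => ?_)
    rw [Real.norm_eq_abs, abs_mul]
    have := lip_abs_le hL x
    simp only [Pi.add_apply]
    nlinarith [abs_nonneg x]
  have i2 : Integrable (fun g => deriv φ g) (gaussianReal 0 1) := by
    refine (integrable_const (L : ℝ)).mono' (measurable_deriv φ).aestronglyMeasurable
      (ae_of_all _ fun x => ?_)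
    exact deriv_abs_le hL x
  have i3 : Integrable (fun g => φ g) (gaussianReal 0 1) := by
    have hb := ((integrable_gauss_pow 0).const_mul |φ 0|).add
      ((integrable_gauss_pow 1).const_mul (L : ℝ))
    refine hb.mono' (by fun_prop) (ae_of_all _ fun x => ?_)
    simpa using lip_abs_le hL x
  rw [hermiteCoeff_one]
  rw [integral_gaussianReal_eq_integral_smul one_ne_zero,
    integral_gaussianReal_eq_integral_smul one_ne_zero]
  rw [integrable_gauss_iff] at i1 i2 i3
  have := integral_mul_deriv_eq_deriv_mul_of_integrable (u := φ) (v := gaussianPDFReal 0 1)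
    (u' := deriv φ) (v' := fun x => -(x * gaussianPDFReal 0 1 x))
    (fun x _ => (hφ.differentiable x).hasDerivAt) (fun x _ => gpdf_deriv x)
    (i1.neg.congr (ae_of_all _ fun x => by simp only [Pi.neg_apply, Pi.mul_apply]; ring))
    (i2.congr (ae_of_all _ fun x => by simp only [Pi.mul_apply]; ring))
    (i3.congr (ae_of_all _ fun x => by simp only [Pi.mul_apply]; ring))
  have e1 : ∫ x, φ x * -(x * gaussianPDFReal 0 1 x) =
      - ∫ x, gaussianPDFReal 0 1 x • (φ x * x) := by
    rw [← integral_neg]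
    refine integral_congr_ae (ae_of_all _ fun x => ?_)
    simp only [smul_eq_mul]; ring
  have e2 : ∫ x, deriv φ x * gaussianPDFReal 0 1 x = ∫ x, gaussianPDFReal 0 1 x • deriv φ x := by
    refine integral_congr_ae (ae_of_all _ fun x => ?_)
    simp only [smul_eq_mul]; ring
  rw [e1, e2] at this
  linarith

lemma integrable_of_quad {d : ℕ} {Y : (Fin d → ℝ) → ℝ} (hY : Measurable Y) (B : ℝ)
    (a b : Fin d → ℝ) (h : ∀ v, |Y v| ≤ B * (1 + dotp v a ^ 2 + dotp v b ^ 2)) :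
    Integrable Y (rowLaw d) := by
  have hb := (((integrable_const (1 : ℝ)).add (dotp_memLp a).integrable_sq).add
    (dotp_memLp b).integrable_sq).const_mul B
  exact hb.mono' hY.aestronglyMeasurable (ae_of_all _ fun v => h v)

/-- Mean of the base process. -/
lemma mean_base {φ : ℝ → ℝ} (hφ : ActivationAssumptionCore φ) {d : ℕ} (hd : 0 < d)
    {s : Fin d → ℝ} (hs : eNorm s = Real.sqrt d) (u : Fin d → ℝ) :
    ∫ v, φ (dotp v s) * dotp v u ∂(rowLaw d) = hermiteCoeff φ 1 * (dotp s u / d) := by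
  obtain ⟨L, hL⟩ := hφ.lipschitz
  have hm : Measurable φ := hφ.differentiable.continuous.measurable
  have hms := dotp_measurable s
  have hinteg : ∀ x : Fin d → ℝ, Integrable (fun v => φ (dotp v s) * dotp v x) (rowLaw d) := by
    intro x
    refine integrable_of_quad ((hm.comp hms).mul (dotp_measurable x)) (|φ 0| + L) s x fun v => ?_
    rw [abs_mul]
    have h1 := lip_abs_le hL (dotp v s)
    have h2 : |dotp v x| ≤ 1 + dotp v s ^ 2 + dotp v x ^ 2 := by
      have := sq_abs (dotp v x)
      nlinarith [sq_nonneg (|dotp v x| - 1), sq_nonneg (dotp v s)]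
    have h3 : |dotp v s| * |dotp v x| ≤ 1 + dotp v s ^ 2 + dotp v x ^ 2 := by
      have := sq_abs (dotp v x)
      have := sq_abs (dotp v s)
      nlinarith [sq_nonneg (|dotp v x| - |dotp v s|)]
    calc |φ (dotp v s)| * |dotp v x| ≤ (|φ 0| + L * |dotp v s|) * |dotp v x| := by gcongr
      _ = |φ 0| * |dotp v x| + L * (|dotp v s| * |dotp v x|) := by ring
      _ ≤ |φ 0| * (1 + dotp v s ^ 2 + dotp v x ^ 2)
          + L * (1 + dotp v s ^ 2 + dotp v x ^ 2) := by gcongr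
      _ = _ := by ring
  set c := dotp s u / d with hc
  have hdne : (d : ℝ) ≠ 0 := by positivity
  have horth : dotp s (u - c • s) = 0 := by
    rw [dotp_sub_right, dotp_smul_right, dotp_self_of_sph hs, hc]
    field_simp; ring
  have e : ∀ v, φ (dotp v s) * dotp v u = c * (φ (dotp v s) * dotp v s)
      + φ (dotp v s) * dotp v (u - c • s) := by
    intro v; rw [dotp_sub_right, dotp_smul_right]; ring
  simp_rw [e]
  rw [integral_add ((hinteg s).const_mul c) (hinteg _), integral_const_mul,
    integral_dotp hd hs (f := fun g => φ g * g) (by fun_prop), ← hermiteCoeff_one]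
  have hind := (dotp_indep horth).comp (φ := φ) (ψ := id) hm measurable_id
  have := hind.integral_fun_mul_eq_mul_integral
    ((hm.comp hms).aestronglyMeasurable) (dotp_measurable _).aestronglyMeasurable
  simp only [Function.comp, id] at this
  rw [this, dotp_mean]
  ring

/-- Mean of the derivative process. -/
lemma mean_deriv {φ : ℝ → ℝ} (hφ : ActivationAssumptionCore φ) {d : ℕ} (hd : 0 < d)
    {s w : Fin d → ℝ} (hs : eNorm s = Real.sqrt d) (hsw : dotp s w = 0) (u : Fin d → ℝ) :
    ∫ v, deriv φ (dotp v s) * dotp v w * dotp v u ∂(rowLaw d)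
      = hermiteCoeff φ 1 * (dotp w u / d) := by
  obtain ⟨L, hL⟩ := hφ.lipschitz
  have hm : Measurable (deriv φ) := measurable_deriv φ
  have hms := dotp_measurable s
  have hinteg : ∀ x y : Fin d → ℝ,
      Integrable (fun v => deriv φ (dotp v s) * dotp v x * dotp v y) (rowLaw d) := by
    intro x y
    refine integrable_of_quad (((hm.comp hms).mul (dotp_measurable x)).mul (dotp_measurable y))
      L x y fun v => ?_
    rw [abs_mul, abs_mul, mul_assoc]
    have h1 := deriv_abs_le hL (dotp v s)
    have h3 : |dotp v x| * |dotp v y| ≤ 1 + dotp v x ^ 2 + dotp v y ^ 2 := by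
      have := sq_abs (dotp v x)
      have := sq_abs (dotp v y)
      nlinarith [sq_nonneg (|dotp v x| - |dotp v y|)]
    gcongr
  have hq : ∀ x : Fin d → ℝ, dotp s x = 0 →
      ∫ v, deriv φ (dotp v s) * dotp v x * dotp v x ∂(rowLaw d)
        = hermiteCoeff φ 1 * (dotp x x / d) := by
    intro x hx
    have hind := (dotp_indep hx).comp (φ := deriv φ) (ψ := fun z => z ^ 2) hm (by fun_prop)
    have := hind.integral_fun_mul_eq_mul_integral
      ((hm.comp hms).aestronglyMeasurable) ((dotp_measurable _).pow_const 2).aestronglyMeasurable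
    simp only [Function.comp] at this
    rw [dotp_sq_mean, integral_dotp hd hs hm, stein hφ] at this
    rw [← this]
    refine integral_congr_ae (ae_of_all _ fun v => ?_)
    simp only; ring
  have hpol : ∀ y : Fin d → ℝ, dotp s y = 0 →
      ∫ v, deriv φ (dotp v s) * dotp v w * dotp v y ∂(rowLaw d)
        = hermiteCoeff φ 1 * (dotp w y / d) := by
    intro y hy
    have h1 := hq (w + y) (by rw [dotp_add_right, hsw, hy, add_zero])
    have h2 := hq (w - y) (by rw [dotp_sub_right, hsw, hy, sub_zero])
    have e : ∀ v, deriv φ (dotp v s) * dotp v w * dotp v y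
        = (1/4) * (deriv φ (dotp v s) * dotp v (w + y) * dotp v (w + y)
          - deriv φ (dotp v s) * dotp v (w - y) * dotp v (w - y)) := by
      intro v; rw [dotp_sub_right, dotp_add_right]; ring
    simp_rw [e]
    rw [integral_const_mul, integral_sub (hinteg _ _) (hinteg _ _), h1, h2]
    have e1 : dotp (w + y) (w + y) = dotp w w + 2 * dotp w y + dotp y y := by
      rw [dotp_add_right, dotp_comm (w + y) w, dotp_comm (w + y) y, dotp_add_right,
        dotp_add_right, dotp_comm y w]; ring
    have e2 : dotp (w - y) (w - y) = dotp w w - 2 * dotp w y + dotp y y := by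
      rw [dotp_sub_right, dotp_comm (w - y) w, dotp_comm (w - y) y, dotp_sub_right,
        dotp_sub_right, dotp_comm y w]; ring
    rw [e1, e2]; ring
  set c := dotp s u / d with hc
  have hdne : (d : ℝ) ≠ 0 := by positivity
  have horth : dotp s (u - c • s) = 0 := by
    rw [dotp_sub_right, dotp_smul_right, dotp_self_of_sph hs, hc]
    field_simp; ring
  have e : ∀ v, deriv φ (dotp v s) * dotp v w * dotp v u
      = c * (deriv φ (dotp v s) * dotp v w * dotp v s)
      + deriv φ (dotp v s) * dotp v w * dotp v (u - c • s) := by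
    intro v; rw [dotp_sub_right, dotp_smul_right]; ring
  simp_rw [e]
  rw [integral_add ((hinteg w s).const_mul c) (hinteg _ _), integral_const_mul, hpol _ horth]
  have hz : ∫ v, deriv φ (dotp v s) * dotp v w * dotp v s ∂(rowLaw d) = 0 := by
    have hind := (dotp_indep hsw).comp (φ := fun z => deriv φ z * z) (ψ := id)
      (hm.mul measurable_id) measurable_id
    have := hind.integral_fun_mul_eq_mul_integral
      (((hm.mul measurable_id).comp hms).aestronglyMeasurable)
      (dotp_measurable _).aestronglyMeasurable
    simp only [Function.comp, id] at this
    rw [dotp_mean, mul_zero] at this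
    rw [← this]
    refine integral_congr_ae (ae_of_all _ fun v => ?_)
    simp only; ring
  rw [hz, dotp_sub_right, dotp_smul_right, dotp_comm w s, hsw]
  ring

lemma exp_le_quad (x : ℝ) : Real.exp x ≤ 1 + x + x ^ 2 * Real.exp |x| := by
  have h := Complex.norm_exp_sub_sum_le_norm_mul_exp (x : ℂ) 2
  simp only [Finset.sum_range_succ, Finset.sum_range_zero] at h
  norm_num at h
  have h2 : ‖Complex.exp x - (1 + x)‖ = |Real.exp x - (1 + x)| := by
    rw [← Real.norm_eq_abs, ← Complex.norm_real]
    push_cast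
    rfl
  rw [h2] at h
  have := le_abs_self (Real.exp x - (1 + x))
  linarith

lemma sq_le_two_exp (t : ℝ) (ht : 0 ≤ t) : t ^ 2 ≤ 2 * Real.exp t := by
  have := Real.quadratic_le_exp_of_nonneg ht
  nlinarith

/-- mgf constant -/
def Kc (B : ℝ) : ℝ := 2 * (24 * B) ^ 2 * (Real.exp (1 / 12) * (3 * Mexp)) + 1

lemma Kc_pos (B : ℝ) : 0 < Kc B := by
  have := Mexp_nonneg
  unfold Kc; positivity

lemma mgf_row {d : ℕ} (hd : 0 < d) {B : ℝ} (hB : 0 < B) {Y : (Fin d → ℝ) → ℝ} (hY : Measurable Y)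
    (a : Fin 3 → Fin d → ℝ) (ha : ∀ i, eNorm (a i) = Real.sqrt d)
    (hb : ∀ v, |Y v| ≤ B * (1 + ∑ i, dotp v (a i) ^ 2)) (hmean : ∫ v, Y v ∂(rowLaw d) = 0)
    {l : ℝ} (hl : |l| ≤ 1 / (24 * B)) :
    Integrable (fun v => Real.exp (l * Y v)) (rowLaw d) ∧
    ∫ v, Real.exp (l * Y v) ∂(rowLaw d) ≤ Real.exp (Kc B * l ^ 2) := by
  have hie : ∀ i, Integrable (fun v => Real.exp (dotp v (a i) ^ 2 / 4)) (rowLaw d) := fun i =>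
    integrable_dotp hd (ha i) integrable_expsq
  have hsum : Integrable (fun v => ∑ i, Real.exp (dotp v (a i) ^ 2 / 4)) (rowLaw d) :=
    integrable_finsetSum _ fun i _ => hie i
  have hYi : Integrable Y (rowLaw d) := by
    have hb2 := ((integrable_const (1 : ℝ)).add (integrable_finsetSum (μ := rowLaw d) Finset.univ
      fun i (_ : i ∈ Finset.univ) => (dotp_memLp (a i)).integrable_sq)).const_mul B
    exact hb2.mono' hY.aestronglyMeasurable (ae_of_all _ fun v => by simpa using hb v)
  have hpt : ∀ v, Real.exp (l * Y v) ≤ 1 + l * Y v + l ^ 2 * (2 * (24 * B) ^ 2 *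
      (Real.exp (1 / 12) * ∑ i, Real.exp (dotp v (a i) ^ 2 / 4))) := by
    intro v
    refine (exp_le_quad _).trans ?_
    set t := |Y v| / (24 * B) with ht
    have ht0 : 0 ≤ t := by positivity
    have hYt : |Y v| = 24 * B * t := by rw [ht]; field_simp
    have h1 : |l * Y v| ≤ t := by
      rw [abs_mul, ht, div_eq_mul_one_div, mul_comm]; gcongr
    have h2 : (Y v) ^ 2 = (24 * B) ^ 2 * t ^ 2 := by rw [← sq_abs, hYt]; ring
    have h3 : t + t ≤ 1 / 12 + ∑ i, dotp v (a i) ^ 2 / 12 := by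
      have := hb v
      rw [hYt] at this
      have h4 : B * (24 * t) ≤ B * (1 + ∑ i, dotp v (a i) ^ 2) := by linarith
      have h5 := le_of_mul_le_mul_left h4 hB
      rw [← Finset.sum_div]
      linarith
    have h6 : Real.exp (∑ i, dotp v (a i) ^ 2 / 12) ≤ ∑ i, Real.exp (dotp v (a i) ^ 2 / 4) := by
      obtain ⟨j, -, hj⟩ := Finset.exists_max_image Finset.univ (fun i => dotp v (a i) ^ 2)
        (Finset.univ_nonempty (α := Fin 3))
      have : ∑ i, dotp v (a i) ^ 2 / 12 ≤ dotp v (a j) ^ 2 / 4 := by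
        calc ∑ i, dotp v (a i) ^ 2 / 12 ≤ ∑ i : Fin 3, dotp v (a j) ^ 2 / 12 := by
              refine Finset.sum_le_sum fun i hi => ?_
              have := hj i hi
              gcongr
          _ = _ := by simp; ring
      calc _ ≤ Real.exp (dotp v (a j) ^ 2 / 4) := Real.exp_le_exp.2 this
        _ ≤ _ := Finset.single_le_sum (f := fun i => Real.exp (dotp v (a i) ^ 2 / 4))
            (fun i _ => (Real.exp_pos _).le) (Finset.mem_univ j)
    have h7 : (l * Y v) ^ 2 * Real.exp |l * Y v| ≤ l ^ 2 * (2 * (24 * B) ^ 2 *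
      (Real.exp (1 / 12) * ∑ i, Real.exp (dotp v (a i) ^ 2 / 4))) := by
      calc (l * Y v) ^ 2 * Real.exp |l * Y v|
          ≤ (l * Y v) ^ 2 * Real.exp t := by gcongr
        _ = l ^ 2 * ((24 * B) ^ 2 * (t ^ 2 * Real.exp t)) := by rw [mul_pow, h2]; ring
        _ ≤ l ^ 2 * ((24 * B) ^ 2 * ((2 * Real.exp t) * Real.exp t)) := by
            gcongr; exact sq_le_two_exp t ht0
        _ = l ^ 2 * (2 * (24 * B) ^ 2 * Real.exp (t + t)) := by rw [Real.exp_add]; ring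
        _ ≤ l ^ 2 * (2 * (24 * B) ^ 2 * Real.exp (1 / 12 + ∑ i, dotp v (a i) ^ 2 / 12)) := by
            gcongr
        _ ≤ _ := by rw [Real.exp_add]; gcongr
    linarith
  have hi2 : Integrable (fun v => 1 + l * Y v + l ^ 2 * (2 * (24 * B) ^ 2 *
      (Real.exp (1 / 12) * ∑ i, Real.exp (dotp v (a i) ^ 2 / 4)))) (rowLaw d) :=
    ((integrable_const _).add (hYi.const_mul l)).add (((hsum.const_mul _).const_mul _).const_mul _)
  have hi1 : Integrable (fun v => Real.exp (l * Y v)) (rowLaw d) := by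
    refine hi2.mono' (by fun_prop) (ae_of_all _ fun v => ?_)
    rw [Real.norm_eq_abs, abs_of_pos (Real.exp_pos _)]
    exact hpt v
  refine ⟨hi1, (integral_mono hi1 hi2 hpt).trans ?_⟩
  have hi3 : Integrable (fun v => 1 + l * Y v) (rowLaw d) :=
    (integrable_const _).add (hYi.const_mul l)
  rw [integral_add hi3
    (((hsum.const_mul _).const_mul _).const_mul _), integral_add (integrable_const _)
    (hYi.const_mul l), integral_const_mul, integral_const_mul, integral_const_mul,
    integral_const_mul, hmean, integral_finsetSum _ fun i _ => hie i]
  have : ∀ i, ∫ v, Real.exp (dotp v (a i) ^ 2 / 4) ∂(rowLaw d) = Mexp := fun i =>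
    integral_dotp hd (ha i) (f := fun g => Real.exp (g ^ 2 / 4)) (by fun_prop)
  simp only [this]
  have h8 := Real.add_one_le_exp (Kc B * l ^ 2)
  have h9 : (Kc B - 1) * l ^ 2 ≤ Kc B * l ^ 2 := by nlinarith [sq_nonneg l]
  simp only [integral_const, probReal_univ, Finset.sum_const, Finset.card_univ, Fintype.card_fin]
  simp only [smul_eq_mul, nsmul_eq_mul]
  unfold Kc at h8 h9 ⊢
  push_cast
  nlinarith

lemma chernoff_one {d p : ℕ} (hd : 0 < d) {B : ℝ} (hB : 0 < B) {Y : (Fin d → ℝ) → ℝ}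
    (hY : Measurable Y)
    (a : Fin 3 → Fin d → ℝ) (ha : ∀ i, eNorm (a i) = Real.sqrt d)
    (hb : ∀ v, |Y v| ≤ B * (1 + ∑ i, dotp v (a i) ^ 2)) (hmean : ∫ v, Y v ∂(rowLaw d) = 0)
    {l : ℝ} (hl0 : 0 ≤ l) (hl : |l| ≤ 1 / (24 * B)) (η : ℝ) :
    (gaussianMatrix p d).real {V | p * η ≤ ∑ k, Y (V k)} ≤
      Real.exp (-(p * (l * η - Kc B * l ^ 2))) := by
  have hm := mgf_row hd hB hY a ha hb hmean hl
  have : IsProbabilityMeasure (gaussianMatrix p d) := by unfold gaussianMatrix; infer_instance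
  have hind : iIndepFun (fun (k : Fin p) (V : Fin p → Fin d → ℝ) => Y (V k))
      (gaussianMatrix p d) :=
    iIndepFun_pi (μ := fun _ : Fin p => rowLaw d) (X := fun _ => Y) (fun i => hY.aemeasurable)
  have hmeas : ∀ k : Fin p, Measurable (fun V : Fin p → Fin d → ℝ => Y (V k)) := fun k =>
    hY.comp (measurable_pi_apply k)
  have hpres := fun k => measurePreserving_eval (fun _ : Fin p => rowLaw d) k
  have hinteg : ∀ k : Fin p, Integrable (fun V : Fin p → Fin d → ℝ => Real.exp (l * Y (V k)))
      (gaussianMatrix p d) := fun k =>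
    (hpres k).integrable_comp_of_integrable hm.1
  have hmgf : ∀ k : Fin p, mgf (fun V : Fin p → Fin d → ℝ => Y (V k)) (gaussianMatrix p d) l
      ≤ Real.exp (Kc B * l ^ 2) := by
    intro k
    refine le_trans (le_of_eq ?_) hm.2
    unfold mgf
    have := integral_map (μ := gaussianMatrix p d) (φ := fun V : Fin p → Fin d → ℝ => V k)
      (f := fun v => Real.exp (l * Y v)) (measurable_pi_apply k).aemeasurable
      (by fun_prop)
    rw [← this]
    congr 1
    exact (hpres k).map_eq
  have hS := hind.mgf_sum hmeas Finset.univ (t := l)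
  have hI := hind.integrable_exp_mul_sum hmeas (s := Finset.univ) (t := l) (fun k _ => hinteg k)
  have h := measure_ge_le_exp_mul_mgf (p * η) hl0 hI
  rw [hS] at h
  simp only [Finset.sum_apply] at h
  refine h.trans ?_
  calc Real.exp (-l * (p * η)) * ∏ k : Fin p, mgf (fun V : Fin p → Fin d → ℝ => Y (V k))
        (gaussianMatrix p d) l
      ≤ Real.exp (-l * (p * η)) * ∏ k : Fin p, Real.exp (Kc B * l ^ 2) := by
        gcongr with k
        · exact fun k _ => mgf_nonneg
        · exact hmgf k
    _ = _ := by
        rw [Finset.prod_const, Finset.card_univ, Fintype.card_fin, ← Real.exp_nat_mul,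
          ← Real.exp_add]
        congr 1; ring

/-- Bernstein-type rate. -/
def lrate (B η : ℝ) : ℝ := min (1 / (24 * B)) (η / (2 * Kc B))

def crate (B η : ℝ) : ℝ := lrate B η * η / 2

lemma lrate_pos {B η : ℝ} (hB : 0 < B) (hη : 0 < η) : 0 < lrate B η := by
  have := Kc_pos B
  unfold lrate; positivity

lemma crate_pos {B η : ℝ} (hB : 0 < B) (hη : 0 < η) : 0 < crate B η := by
  have := lrate_pos hB hη
  unfold crate; positivity

lemma chernoff {d p : ℕ} (hd : 0 < d) {B η : ℝ} (hB : 0 < B) (hη : 0 < η) {Y : (Fin d → ℝ) → ℝ}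
    (hY : Measurable Y)
    (a : Fin 3 → Fin d → ℝ) (ha : ∀ i, eNorm (a i) = Real.sqrt d)
    (hb : ∀ v, |Y v| ≤ B * (1 + ∑ i, dotp v (a i) ^ 2)) (hmean : ∫ v, Y v ∂(rowLaw d) = 0) :
    (gaussianMatrix p d).real {V | p * η ≤ |∑ k, Y (V k)|} ≤ 2 * Real.exp (-(crate B η * p)) := by
  have : IsProbabilityMeasure (gaussianMatrix p d) := by unfold gaussianMatrix; infer_instance
  have hl := lrate_pos hB hη
  have hK := Kc_pos B
  have hl2 : |lrate B η| ≤ 1 / (24 * B) := by rw [abs_of_pos hl]; exact min_le_left _ _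
  have h1 := chernoff_one (p := p) hd hB hY a ha hb hmean hl.le hl2 η
  have h2 := chernoff_one (p := p) hd hB hY.neg a ha (by simpa using hb)
    (by simp only [Pi.neg_apply]; rw [integral_neg, hmean, neg_zero]) hl.le hl2 η
  have h3 : Real.exp (-(p * (lrate B η * η - Kc B * lrate B η ^ 2)))
      ≤ Real.exp (-(crate B η * p)) := by
    apply Real.exp_le_exp.2
    have : Kc B * lrate B η ≤ η / 2 := by
      have : lrate B η ≤ η / (2 * Kc B) := min_le_right _ _
      rw [le_div_iff₀ (by positivity)] at this
      linarith
    have h4 : lrate B η * (Kc B * lrate B η) ≤ lrate B η * (η / 2) := by gcongr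
    have h5 : crate B η ≤ lrate B η * η - Kc B * lrate B η ^ 2 := by unfold crate; nlinarith
    have hp : (0 : ℝ) ≤ p := Nat.cast_nonneg p
    nlinarith
  have hsub : {V : Fin p → Fin d → ℝ | p * η ≤ |∑ k, Y (V k)|} ⊆
      {V | p * η ≤ ∑ k, Y (V k)} ∪ {V | p * η ≤ ∑ k, (-Y) (V k)} := by
    intro V hV
    simp only [Set.mem_ofPred_eq, Set.mem_union, Pi.neg_apply, Finset.sum_neg_distrib] at hV ⊢
    exact le_abs.1 hV
  have := (measureReal_mono hsub (μ := gaussianMatrix p d)).trans (measureReal_union_le _ _)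
  linarith

instance gaussianMatrix_prob (p d : ℕ) : IsProbabilityMeasure (gaussianMatrix p d) := by
  unfold gaussianMatrix; infer_instance

lemma exists_net {d : ℕ} (T : Set (Fin 3 → Fin d → ℝ))
    (hT : ∀ θ ∈ T, ∀ i j, |θ i j| ≤ d) (m : ℕ) (hm : 0 < m) :
    ∃ N : Finset (Fin 3 → Fin d → ℝ), (∀ θ ∈ N, θ ∈ T) ∧ N.card ≤ (2 * m * d + 1) ^ (3 * d) ∧
      ∀ θ ∈ T, ∃ θ' ∈ N, ∀ i j, |θ i j - θ' i j| ≤ 1 / (m : ℝ) := by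
  classical
  let κ : (Fin 3 → Fin d → ℝ) → (Fin 3 → Fin d → ℤ) := fun θ i j => ⌊(m : ℝ) * θ i j⌋
  let S : Finset (Fin 3 → Fin d → ℤ) := Fintype.piFinset fun _ => Fintype.piFinset fun _ =>
    Finset.Icc (-((m : ℤ) * d)) ((m : ℤ) * d)
  have hr : ∀ c : Fin 3 → Fin d → ℤ, ∃ θ : Fin 3 → Fin d → ℝ,
      (∃ θ ∈ T, κ θ = c) → (θ ∈ T ∧ κ θ = c) := by
    intro c
    by_cases h : ∃ θ ∈ T, κ θ = c
    · obtain ⟨θ, h1, h2⟩ := h; exact ⟨θ, fun _ => ⟨h1, h2⟩⟩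
    · exact ⟨0, fun h' => absurd h' h⟩
  choose r hr using hr
  have hm' : (0 : ℝ) < m := by exact_mod_cast hm
  refine ⟨(S.filter fun c => ∃ θ ∈ T, κ θ = c).image r, ?_, ?_, ?_⟩
  · intro θ hθ
    obtain ⟨c, hc, rfl⟩ := Finset.mem_image.1 hθ
    exact (hr c (Finset.mem_filter.1 hc).2).1
  · refine Finset.card_image_le.trans ((Finset.card_filter_le _ _).trans (le_of_eq ?_))
    simp only [S, Fintype.card_piFinset_const, Int.card_Icc]
    have : ((m : ℤ) * d + 1 - -((m : ℤ) * d)).toNat = 2 * m * d + 1 := by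
      have : ((m : ℤ) * d + 1 - -((m : ℤ) * d)) = ((2 * m * d + 1 : ℕ) : ℤ) := by push_cast; ring
      rw [this]; exact Int.toNat_natCast _
    rw [this, ← pow_mul, mul_comm d 3]
  · intro θ hθ
    have hk := hr (κ θ) ⟨θ, hθ, rfl⟩
    refine ⟨r (κ θ), Finset.mem_image.2 ⟨κ θ, Finset.mem_filter.2 ⟨?_, θ, hθ, rfl⟩, rfl⟩, ?_⟩
    · simp only [S, Fintype.mem_piFinset, Finset.mem_Icc]
      intro i j
      have := abs_le.1 (hT θ hθ i j)
      constructor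
      · refine Int.le_floor.2 ?_
        push_cast
        nlinarith
      · have h2 : (⌊(m : ℝ) * θ i j⌋ : ℝ) ≤ m * d := (Int.floor_le _).trans (by nlinarith)
        exact_mod_cast h2
    · intro i j
      have h2 : ⌊(m : ℝ) * r (κ θ) i j⌋ = ⌊(m : ℝ) * θ i j⌋ := congrFun (congrFun hk.2 i) j
      have a1 := Int.floor_le ((m : ℝ) * r (κ θ) i j)
      have a2 := Int.lt_floor_add_one ((m : ℝ) * r (κ θ) i j)
      have b1 := Int.floor_le ((m : ℝ) * θ i j)
      have b2 := Int.lt_floor_add_one ((m : ℝ) * θ i j)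
      rw [h2] at a1 a2
      rw [abs_le]
      constructor
      · rw [← neg_div, div_le_iff₀ hm']; nlinarith
      · rw [le_div_iff₀ hm']; nlinarith

lemma unif {d p : ℕ} (hd : 0 < d) (hdp : d ≤ p) (hp3 : 3 ≤ p) {B η C0 : ℝ} (hB : 0 < B)
    (hη : 0 < η) (hC : C0 ≤ η * p) (T : Set (Fin 3 → Fin d → ℝ))
    (hT : ∀ θ ∈ T, ∀ i, eNorm (θ i) = Real.sqrt d)
    (Y : (Fin d → ℝ) → (Fin 3 → Fin d → ℝ) → ℝ)
    (hY : ∀ θ, Measurable fun v => Y v θ)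
    (hb : ∀ θ ∈ T, ∀ v, |Y v θ| ≤ B * (1 + ∑ i, dotp v (θ i) ^ 2))
    (hmean : ∀ θ ∈ T, ∫ v, Y v θ ∂(rowLaw d) = 0)
    (hlip : ∀ v : Fin d → ℝ, (∀ j, |v j| ≤ p) → ∀ θ ∈ T, ∀ θ' ∈ T, ∀ r : ℝ, 0 ≤ r →
      (∀ i j, |θ i j - θ' i j| ≤ r) → |Y v θ - Y v θ'| ≤ C0 * (p : ℝ) ^ 8 * r) :
    ∃ E : Set (Fin p → Fin d → ℝ),
      (gaussianMatrix p d).real E ≤ (p : ℝ) ^ (33 * d) * (2 * Real.exp (-(crate B η * p))) ∧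
      ∀ V, V ∉ E → (∀ k j, |V k j| ≤ p) → ∀ θ ∈ T, |∑ k, Y (V k) θ| ≤ 2 * (p * η) := by
  have hp0 : (0 : ℝ) < p := by exact_mod_cast (by omega : 0 < p)
  have hTd : ∀ θ ∈ T, ∀ i j, |θ i j| ≤ d := by
    intro θ hθ i j
    have h1 : θ i j ^ 2 ≤ d := by
      rw [← dotp_self_of_sph (hT θ hθ i)]
      have := Finset.single_le_sum (f := fun j => θ i j * θ i j)
        (fun j _ => mul_self_nonneg _) (Finset.mem_univ j)
      calc θ i j ^ 2 = θ i j * θ i j := by ring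
        _ ≤ _ := this
    have h2 : (1 : ℝ) ≤ d := by exact_mod_cast hd
    refine abs_le_of_sq_le_sq (h1.trans ?_) (by positivity)
    nlinarith
  obtain ⟨N, hN1, hN2, hN3⟩ := exists_net T hTd (p ^ 9) (by positivity)
  refine ⟨⋃ θ ∈ N, {V | p * η ≤ |∑ k, Y (V k) θ|}, ?_, ?_⟩
  · refine (measureReal_biUnion_finset_le _ _).trans ?_
    calc ∑ θ ∈ N, (gaussianMatrix p d).real {V | p * η ≤ |∑ k, Y (V k) θ|}
        ≤ ∑ θ ∈ N, 2 * Real.exp (-(crate B η * p)) := by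
          refine Finset.sum_le_sum fun θ hθ => ?_
          exact chernoff hd hB hη (hY θ) θ (hT θ (hN1 θ hθ)) (hb θ (hN1 θ hθ))
            (hmean θ (hN1 θ hθ))
      _ = N.card * (2 * Real.exp (-(crate B η * p))) := by simp
      _ ≤ _ := by
          gcongr
          have h1 : 2 * p ^ 9 * d + 1 ≤ p ^ 11 := by
            have h2 : 2 * p ^ 9 * d ≤ 2 * p ^ 9 * p := by gcongr
            have h3 : 1 ≤ p ^ 10 := Nat.one_le_pow _ _ (by omega)
            calc 2 * p ^ 9 * d + 1 ≤ 2 * p ^ 9 * p + p ^ 10 := by omega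
              _ = 3 * p ^ 10 := by ring
              _ ≤ p * p ^ 10 := by gcongr
              _ = _ := by ring
          have h4 : N.card ≤ p ^ (33 * d) := by
            refine hN2.trans ((Nat.pow_le_pow_left h1 _).trans (le_of_eq ?_))
            rw [← pow_mul]; congr 1; ring
          exact_mod_cast h4
  · intro V hV hVb θ hθ
    obtain ⟨θ', hθ', hclose⟩ := hN3 θ hθ
    have h1 : |∑ k, Y (V k) θ'| < p * η := by
      by_contra hcon
      exact hV (Set.mem_biUnion hθ' (not_lt.1 hcon))
    have h2 : |∑ k, Y (V k) θ - ∑ k, Y (V k) θ'| ≤ p * η := by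
      rw [← Finset.sum_sub_distrib]
      refine (Finset.abs_sum_le_sum_abs _ _).trans ?_
      calc ∑ k, |Y (V k) θ - Y (V k) θ'| ≤ ∑ k : Fin p, η := by
            refine Finset.sum_le_sum fun k _ => ?_
            refine (hlip (V k) (hVb k) θ hθ θ' (hN1 _ hθ') _ (by positivity) hclose).trans ?_
            push_cast
            rw [mul_one_div, div_le_iff₀ (by positivity)]
            calc C0 * (p : ℝ) ^ 8 ≤ η * p * p ^ 8 := by gcongr
              _ = _ := by ring
        _ = p * η := by simp
    have := abs_sub_abs_le_abs_sub (∑ k, Y (V k) θ) (∑ k, Y (V k) θ')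
    linarith

lemma coord_event {d p : ℕ} (hd : 0 < d) :
    (gaussianMatrix p d).real {V | ¬ ∀ k j, |V k j| ≤ p} ≤
      p * (d * (Mexp * Real.exp (-((p : ℝ) ^ 2 / 4)))) := by
  have hd1 : (1 : ℝ) ≤ d := by exact_mod_cast hd
  have hone : ∀ (k : Fin p) (j : Fin d), (gaussianMatrix p d).real {V | (p : ℝ) < |V k j|}
      ≤ Mexp * Real.exp (-((p : ℝ) ^ 2 / 4)) := by
    intro k j
    let x : Fin d → ℝ := fun i => if i = j then Real.sqrt d else 0
    have hx : eNorm x = Real.sqrt d := by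
      unfold eNorm
      congr 1
      simp [x]
    have hdot : ∀ v : Fin d → ℝ, dotp v x = v j * Real.sqrt d := by
      intro v; simp [dotp, x]
    have hi := integrable_dotp hd hx integrable_expsq
    have hpres := measurePreserving_eval (fun _ : Fin p => rowLaw d) k
    have hi2 : Integrable (fun V : Fin p → Fin d → ℝ => Real.exp (dotp (V k) x ^ 2 / 4))
      (gaussianMatrix p d) := hpres.integrable_comp_of_integrable hi
    have he : ∫ V, Real.exp (dotp (V k) x ^ 2 / 4) ∂(gaussianMatrix p d) = Mexp := by
      have := integral_map (μ := gaussianMatrix p d) (φ := fun V : Fin p → Fin d → ℝ => V k)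
        (f := fun v => Real.exp (dotp v x ^ 2 / 4)) (measurable_pi_apply k).aemeasurable
        (by have := dotp_measurable x; fun_prop)
      rw [← this]
      have h2 : Measure.map (fun V : Fin p → Fin d → ℝ => V k) (gaussianMatrix p d) = rowLaw d :=
        hpres.map_eq
      rw [h2]
      exact integral_dotp hd hx (f := fun g => Real.exp (g ^ 2 / 4)) (by fun_prop)
    have hmk := mul_meas_ge_le_integral_of_nonneg (μ := gaussianMatrix p d)
      (ae_of_all _ fun V => (Real.exp_pos (dotp (V k) x ^ 2 / 4)).le) hi2
      (Real.exp ((p : ℝ) ^ 2 / 4))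
    rw [he] at hmk
    have hsub : {V : Fin p → Fin d → ℝ | (p : ℝ) < |V k j|} ⊆
        {V | Real.exp ((p : ℝ) ^ 2 / 4) ≤ Real.exp (dotp (V k) x ^ 2 / 4)} := by
      intro V hV
      have hV' : (p : ℝ) < |V k j| := hV
      have h3 : (p : ℝ) ^ 2 ≤ |V k j| ^ 2 := by gcongr
      rw [sq_abs] at h3
      refine Real.exp_le_exp.2 ?_
      rw [hdot, mul_pow, Real.sq_sqrt (Nat.cast_nonneg d)]
      nlinarith [sq_nonneg (V k j)]
    have h4 := measureReal_mono hsub (μ := gaussianMatrix p d)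
    refine h4.trans ?_
    rw [Real.exp_neg, ← div_eq_mul_inv, le_div_iff₀ (Real.exp_pos _)]
    linarith
  have hsub : {V : Fin p → Fin d → ℝ | ¬ ∀ k j, |V k j| ≤ p} ⊆
      ⋃ k, ⋃ j, {V | (p : ℝ) < |V k j|} := by
    intro V hV
    have hV' : ¬ ∀ k j, |V k j| ≤ p := hV
    push Not at hV'
    obtain ⟨k, j, h⟩ := hV'
    exact Set.mem_iUnion.2 ⟨k, Set.mem_iUnion.2 ⟨j, h⟩⟩
  refine (measureReal_mono hsub).trans ((measureReal_iUnion_fintype_le _).trans ?_)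
  calc ∑ k : Fin p, (gaussianMatrix p d).real (⋃ j, {V | (p : ℝ) < |V k j|})
      ≤ ∑ k : Fin p, ∑ j : Fin d, Mexp * Real.exp (-((p : ℝ) ^ 2 / 4)) := by
        refine Finset.sum_le_sum fun k _ => (measureReal_iUnion_fintype_le _).trans ?_
        exact Finset.sum_le_sum fun j _ => hone k j
    _ = _ := by simp

lemma dotp_cs {d : ℕ} {x y : Fin d → ℝ} (hd : 0 < d) (hx : eNorm x = Real.sqrt d)
    (hy : eNorm y = Real.sqrt d) : |dotp x y / d| ≤ 1 := by
  have hd' : (0 : ℝ) < d := by exact_mod_cast hd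
  rw [abs_div, abs_of_pos hd', div_le_one hd']
  have h := Finset.sum_mul_sq_le_sq_mul_sq Finset.univ x y
  have h1 := dotp_self_of_sph hx
  have h2 := dotp_self_of_sph hy
  have h1' : ∑ i, x i ^ 2 = d := by rw [← h1]; exact Finset.sum_congr rfl fun i _ => by ring
  have h2' : ∑ i, y i ^ 2 = d := by rw [← h2]; exact Finset.sum_congr rfl fun i _ => by ring
  rw [h1', h2'] at h
  refine abs_le_of_sq_le_sq ?_ hd'.le
  calc dotp x y ^ 2 ≤ (d : ℝ) * d := h
    _ = _ := by ring

lemma coord_le_of_sph {d : ℕ} {x : Fin d → ℝ} (hd : 0 < d) (hx : eNorm x = Real.sqrt d)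
    (j : Fin d) : |x j| ≤ d := by
  have h1 : x j ^ 2 ≤ d := by
    rw [← dotp_self_of_sph hx]
    have := Finset.single_le_sum (f := fun j => x j * x j)
      (fun j _ => mul_self_nonneg _) (Finset.mem_univ j)
    calc x j ^ 2 = x j * x j := by ring
      _ ≤ _ := this
  have h2 : (1 : ℝ) ≤ d := by exact_mod_cast hd
  refine abs_le_of_sq_le_sq (h1.trans ?_) (by positivity)
  nlinarith

lemma dotp_abs_le {d : ℕ} {v x : Fin d → ℝ} {a b : ℝ} (ha : 0 ≤ a) (hv : ∀ j, |v j| ≤ a)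
    (hx : ∀ j, |x j| ≤ b) : |dotp v x| ≤ d * (a * b) := by
  unfold dotp
  refine (Finset.abs_sum_le_sum_abs _ _).trans ?_
  calc ∑ j, |v j * x j| ≤ ∑ j : Fin d, a * b := by
        refine Finset.sum_le_sum fun j _ => ?_
        rw [abs_mul]
        exact mul_le_mul (hv j) (hx j) (abs_nonneg _) ha
    _ = _ := by simp

/-- base process -/
def Y1 (φ : ℝ → ℝ) {d : ℕ} (v : Fin d → ℝ) (θ : Fin 3 → Fin d → ℝ) : ℝ :=
  φ (dotp v (θ 0)) * dotp v (θ 2) - hermiteCoeff φ 1 * (dotp (θ 0) (θ 2) / d)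

/-- derivative process -/
def Y2 (φ : ℝ → ℝ) {d : ℕ} (v : Fin d → ℝ) (θ : Fin 3 → Fin d → ℝ) : ℝ :=
  deriv φ (dotp v (θ 0)) * dotp v (θ 1) * dotp v (θ 2)
    - hermiteCoeff φ 1 * (dotp (θ 1) (θ 2) / d)

/-- Common part of the Lipschitz estimates. -/
lemma lip_common {d p : ℕ} (hd : 0 < d) (hdp : d ≤ p) {v : Fin d → ℝ} (hv : ∀ j, |v j| ≤ p)
    {θ θ' : Fin 3 → Fin d → ℝ} (hθ : ∀ i, eNorm (θ i) = Real.sqrt d)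
    (hθ' : ∀ i, eNorm (θ' i) = Real.sqrt d) {r : ℝ} (hr : 0 ≤ r)
    (h : ∀ i j, |θ i j - θ' i j| ≤ r) :
    (∀ i, |dotp v (θ i)| ≤ (p : ℝ) ^ 3) ∧ (∀ i, |dotp v (θ' i)| ≤ (p : ℝ) ^ 3) ∧
    (∀ i, |dotp v (θ i) - dotp v (θ' i)| ≤ (p : ℝ) ^ 2 * r) ∧
    (∀ i j, |dotp (θ i) (θ j) / d - dotp (θ' i) (θ' j) / d| ≤ 2 * ((p : ℝ) ^ 2 * r)) := by
  have hd1 : (1 : ℝ) ≤ d := by exact_mod_cast hd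
  have hdp' : (d : ℝ) ≤ p := by exact_mod_cast hdp
  have hp0 : (0 : ℝ) ≤ p := by positivity
  have key : ∀ x : Fin d → ℝ, eNorm x = Real.sqrt d → |dotp v x| ≤ (p : ℝ) ^ 3 := by
    intro x hx
    refine (dotp_abs_le hp0 hv fun j => (coord_le_of_sph hd hx j).trans hdp').trans ?_
    calc (d : ℝ) * (p * p) ≤ p * (p * p) := by gcongr
      _ = _ := by ring
  have key2 : ∀ (u : Fin d → ℝ) (i : Fin 3), (∀ j, |u j| ≤ p) →
      |dotp u (θ i - θ' i)| ≤ (p : ℝ) ^ 2 * r := by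
    intro u i hu
    refine (dotp_abs_le hp0 hu (h i)).trans ?_
    calc (d : ℝ) * (p * r) ≤ p * (p * r) := by gcongr
      _ = _ := by ring
  refine ⟨fun i => key _ (hθ i), fun i => key _ (hθ' i), fun i => ?_, fun i j => ?_⟩
  · rw [← dotp_sub_right]; exact key2 v i hv
  · rw [← sub_div, abs_div, abs_of_pos (by linarith : (0 : ℝ) < d)]
    refine (div_le_self (abs_nonneg _) hd1).trans ?_
    have e : dotp (θ i) (θ j) - dotp (θ' i) (θ' j) =
        dotp (θ i) (θ j - θ' j) + dotp (θ' j) (θ i - θ' i) := by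
      rw [dotp_sub_right, dotp_sub_right, dotp_comm (θ' j) (θ i), dotp_comm (θ' j) (θ' i)]; ring
    rw [e]
    have h1 := key2 (θ i) j fun k => (coord_le_of_sph hd (hθ i) k).trans hdp'
    have h2 := key2 (θ' j) i fun k => (coord_le_of_sph hd (hθ' j) k).trans hdp'
    have := abs_add_le (dotp (θ i) (θ j - θ' j)) (dotp (θ' j) (θ i - θ' i))
    linarith

lemma event_base {φ : ℝ → ℝ} (hφ : ActivationAssumptionCore φ) {L : NNReal}
    (hL : LipschitzWith L φ) {d p : ℕ} (hd : 0 < d) (hdp : d ≤ p) (hp3 : 3 ≤ p) {η : ℝ}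
    (hη : 0 < η)
    (hC : |φ 0| + 2 * L + 2 * |hermiteCoeff φ 1| ≤ η * p) :
    ∃ E : Set (Fin p → Fin d → ℝ),
      (gaussianMatrix p d).real E ≤ (p : ℝ) ^ (33 * d) *
        (2 * Real.exp (-(crate (|φ 0| + L + |hermiteCoeff φ 1| + 1) η * p))) ∧
      ∀ V, V ∉ E → (∀ k j, |V k j| ≤ p) → ∀ s u : Fin d → ℝ, eNorm s = Real.sqrt d →
        eNorm u = Real.sqrt d →
        |∑ k, φ (dotp (V k) s) * dotp (V k) u - p * (hermiteCoeff φ 1 * (dotp s u / d))|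
          ≤ 2 * (p * η) := by
  set μ := hermiteCoeff φ 1 with hμ
  have hp1 : (1 : ℝ) ≤ p := by exact_mod_cast (by omega : 1 ≤ p)
  have hm : Measurable φ := hφ.differentiable.continuous.measurable
  have U := unif (p := p) hd hdp hp3
    (B := |φ 0| + L + |μ| + 1) (by positivity) hη hC
    {θ | ∀ i, eNorm (θ i) = Real.sqrt d} (fun θ hθ => hθ) (Y1 φ)
    (fun θ => ((hm.comp (dotp_measurable _)).mul (dotp_measurable _)).sub_const _)
    ?_ ?_ ?_
  · obtain ⟨E, hE1, hE2⟩ := U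
    refine ⟨E, hE1, fun V hV hVb s u hs hu => ?_⟩
    have := hE2 V hV hVb ![s, s, u] (by intro i; fin_cases i <;> simp [hs, hu])
    simpa [Y1, Finset.sum_sub_distrib] using this
  · intro θ hθ v
    rw [Fin.sum_univ_three]
    have h1 := lip_abs_le hL (dotp v (θ 0))
    have h2 := dotp_cs hd (hθ 0) (hθ 2)
    set a := dotp v (θ 0)
    set b := dotp v (θ 2)
    set c := dotp v (θ 1)
    have h3 : |Y1 φ v θ| ≤ |φ a| * |b| + |μ| * |dotp (θ 0) (θ 2) / d| := by
      rw [← abs_mul, ← abs_mul]; exact abs_sub _ _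
    have h4 : |b| ≤ 1 + b ^ 2 := by rw [← sq_abs b]; nlinarith [sq_nonneg (|b| - 1)]
    have h5 : |a| * |b| ≤ a ^ 2 + b ^ 2 := by
      rw [← sq_abs b, ← sq_abs a]; nlinarith [sq_nonneg (|b| - |a|), sq_nonneg (|b| + |a|)]
    have hS : 0 ≤ a ^ 2 + c ^ 2 + b ^ 2 := by positivity
    calc |Y1 φ v θ| ≤ (|φ 0| + L * |a|) * |b| + |μ| * 1 := by
          refine h3.trans ?_; gcongr
      _ = |φ 0| * |b| + L * (|a| * |b|) + |μ| * 1 := by ring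
      _ ≤ |φ 0| * (1 + (a ^ 2 + c ^ 2 + b ^ 2)) + L * (1 + (a ^ 2 + c ^ 2 + b ^ 2))
          + |μ| * (1 + (a ^ 2 + c ^ 2 + b ^ 2)) := by
          gcongr
          · nlinarith [sq_nonneg a, sq_nonneg c]
          · nlinarith [sq_nonneg a, sq_nonneg c]
          · linarith
      _ ≤ _ := by nlinarith
  · intro θ hθ
    have hi : Integrable (fun v => φ (dotp v (θ 0)) * dotp v (θ 2)) (rowLaw d) := by
      refine integrable_of_quad ((hm.comp (dotp_measurable _)).mul (dotp_measurable _))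
        (|φ 0| + L) (θ 0) (θ 2) fun v => ?_
      have h1 := lip_abs_le hL (dotp v (θ 0))
      set a := dotp v (θ 0)
      set b := dotp v (θ 2)
      have h4 : |b| ≤ 1 + b ^ 2 := by rw [← sq_abs b]; nlinarith [sq_nonneg (|b| - 1)]
      have h5 : |a| * |b| ≤ a ^ 2 + b ^ 2 := by
        rw [← sq_abs b, ← sq_abs a]; nlinarith [sq_nonneg (|b| - |a|), sq_nonneg (|b| + |a|)]
      rw [abs_mul]
      calc |φ a| * |b| ≤ (|φ 0| + L * |a|) * |b| := by gcongr
        _ = |φ 0| * |b| + L * (|a| * |b|) := by ring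
        _ ≤ |φ 0| * (1 + a ^ 2 + b ^ 2) + L * (1 + a ^ 2 + b ^ 2) := by
            gcongr
            · nlinarith [sq_nonneg a]
            · nlinarith
        _ = _ := by ring
    simp only [Y1]
    rw [integral_sub hi (integrable_const _), mean_base hφ hd (hθ 0)]
    simp
  · intro v hv θ hθ θ' hθ' r hr h
    obtain ⟨c1, c2, c3, c4⟩ := lip_common hd hdp hv hθ hθ' hr h
    have hl := hL.dist_le_mul (dotp v (θ 0)) (dotp v (θ' 0))
    rw [Real.dist_eq, Real.dist_eq] at hl
    have h1 := lip_abs_le hL (dotp v (θ 0))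
    have e : Y1 φ v θ - Y1 φ v θ' =
      φ (dotp v (θ 0)) * (dotp v (θ 2) - dotp v (θ' 2))
      + (φ (dotp v (θ 0)) - φ (dotp v (θ' 0))) * dotp v (θ' 2)
      - μ * (dotp (θ 0) (θ 2) / d - dotp (θ' 0) (θ' 2) / d) := by
      simp only [Y1, ← hμ]; ring
    have hp28 : (p : ℝ) ^ 2 ≤ (p : ℝ) ^ 8 := pow_le_pow_right₀ hp1 (by norm_num)
    have hp58 : (p : ℝ) ^ 5 ≤ (p : ℝ) ^ 8 := pow_le_pow_right₀ hp1 (by norm_num)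
    rw [e]
    refine (abs_sub _ _).trans ((add_le_add_left (abs_add_le _ _) _).trans ?_)
    rw [abs_mul, abs_mul, abs_mul]
    calc _ ≤ (|φ 0| + L * (p : ℝ) ^ 3) * ((p : ℝ) ^ 2 * r)
          + (L * ((p : ℝ) ^ 2 * r)) * (p : ℝ) ^ 3 + |μ| * (2 * ((p : ℝ) ^ 2 * r)) := by
          gcongr
          · exact h1.trans (by gcongr; exact c1 0)
          · exact c3 2
          · exact hl.trans (by gcongr; exact c3 0)
          · exact c2 2
          · exact c4 0 2
      _ = |φ 0| * ((p : ℝ) ^ 2 * r) + 2 * L * ((p : ℝ) ^ 5 * r)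
          + 2 * |μ| * ((p : ℝ) ^ 2 * r) := by ring
      _ ≤ |φ 0| * ((p : ℝ) ^ 8 * r) + 2 * L * ((p : ℝ) ^ 8 * r)
          + 2 * |μ| * ((p : ℝ) ^ 8 * r) := by gcongr
      _ = _ := by ring

lemma event_deriv {φ : ℝ → ℝ} (hφ : ActivationAssumptionCore φ) {L L' : NNReal}
    (hL : LipschitzWith L φ) (hL' : LipschitzWith L' (deriv φ))
    {d p : ℕ} (hd : 0 < d) (hdp : d ≤ p) (hp3 : 3 ≤ p) {η : ℝ} (hη : 0 < η)
    (hC : L' + 2 * L + 2 * |hermiteCoeff φ 1| ≤ η * p) :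
    ∃ E : Set (Fin p → Fin d → ℝ),
      (gaussianMatrix p d).real E ≤ (p : ℝ) ^ (33 * d) *
        (2 * Real.exp (-(crate (L + |hermiteCoeff φ 1| + 1) η * p))) ∧
      ∀ V, V ∉ E → (∀ k j, |V k j| ≤ p) → ∀ s w u : Fin d → ℝ, eNorm s = Real.sqrt d →
        eNorm w = Real.sqrt d → eNorm u = Real.sqrt d → dotp s w = 0 →
        |∑ k, deriv φ (dotp (V k) s) * dotp (V k) w * dotp (V k) u
          - p * (hermiteCoeff φ 1 * (dotp w u / d))| ≤ 2 * (p * η) := by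
  set μ := hermiteCoeff φ 1 with hμ
  have hp1 : (1 : ℝ) ≤ p := by exact_mod_cast (by omega : 1 ≤ p)
  have hm : Measurable (deriv φ) := measurable_deriv φ
  have hmY : ∀ θ : Fin 3 → Fin d → ℝ, Measurable
      (fun v => deriv φ (dotp v (θ 0)) * dotp v (θ 1) * dotp v (θ 2)) := fun θ =>
    ((hm.comp (dotp_measurable _)).mul (dotp_measurable _)).mul (dotp_measurable _)
  have U := unif (p := p) hd hdp hp3
    (B := L + |μ| + 1) (by positivity) hη hC
    {θ | (∀ i, eNorm (θ i) = Real.sqrt d) ∧ dotp (θ 0) (θ 1) = 0} (fun θ hθ => hθ.1) (Y2 φ)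
    (fun θ => (hmY θ).sub_const _)
    ?_ ?_ ?_
  · obtain ⟨E, hE1, hE2⟩ := U
    refine ⟨E, hE1, fun V hV hVb s w u hs hw hu hsw => ?_⟩
    have := hE2 V hV hVb ![s, w, u] ⟨by intro i; fin_cases i <;> simp [hs, hu, hw], by simpa⟩
    simpa [Y2, Finset.sum_sub_distrib] using this
  · intro θ hθ v
    rw [Fin.sum_univ_three]
    have h1 := deriv_abs_le hL (dotp v (θ 0))
    have h2 := dotp_cs hd (hθ.1 1) (hθ.1 2)
    set a := dotp v (θ 0)
    set b := dotp v (θ 2)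
    set c := dotp v (θ 1)
    have h3 : |Y2 φ v θ| ≤ |deriv φ a| * |c| * |b| + |μ| * |dotp (θ 1) (θ 2) / d| := by
      rw [← abs_mul, ← abs_mul, ← abs_mul]; exact abs_sub _ _
    have h5 : |c| * |b| ≤ c ^ 2 + b ^ 2 := by
      rw [← sq_abs b, ← sq_abs c]; nlinarith [sq_nonneg (|b| - |c|), sq_nonneg (|b| + |c|)]
    have hS : 0 ≤ a ^ 2 + c ^ 2 + b ^ 2 := by positivity
    calc |Y2 φ v θ| ≤ L * |c| * |b| + |μ| * 1 := by
          refine h3.trans ?_; gcongr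
      _ = L * (|c| * |b|) + |μ| * 1 := by ring
      _ ≤ L * (1 + (a ^ 2 + c ^ 2 + b ^ 2))
          + |μ| * (1 + (a ^ 2 + c ^ 2 + b ^ 2)) := by
          gcongr
          · nlinarith [sq_nonneg a]
          · linarith
      _ ≤ _ := by nlinarith
  · intro θ hθ
    have hi : Integrable (fun v => deriv φ (dotp v (θ 0)) * dotp v (θ 1) * dotp v (θ 2))
        (rowLaw d) := by
      refine integrable_of_quad (hmY θ) L (θ 1) (θ 2) fun v => ?_
      have h1 := deriv_abs_le hL (dotp v (θ 0))
      set a := dotp v (θ 0)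
      set b := dotp v (θ 2)
      set c := dotp v (θ 1)
      have h5 : |c| * |b| ≤ c ^ 2 + b ^ 2 := by
        rw [← sq_abs b, ← sq_abs c]; nlinarith [sq_nonneg (|b| - |c|), sq_nonneg (|b| + |c|)]
      rw [abs_mul, abs_mul]
      calc |deriv φ a| * |c| * |b| ≤ L * |c| * |b| := by gcongr
        _ = L * (|c| * |b|) := by ring
        _ ≤ _ := by
            gcongr
            linarith
    simp only [Y2]
    rw [integral_sub hi (integrable_const _), mean_deriv hφ hd (hθ.1 0) hθ.2]
    simp
  · intro v hv θ hθ θ' hθ' r hr h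
    obtain ⟨c1, c2, c3, c4⟩ := lip_common hd hdp hv hθ.1 hθ'.1 hr h
    have hl := hL'.dist_le_mul (dotp v (θ 0)) (dotp v (θ' 0))
    rw [Real.dist_eq, Real.dist_eq] at hl
    have h1 := deriv_abs_le hL (dotp v (θ 0))
    have e : Y2 φ v θ - Y2 φ v θ' =
      deriv φ (dotp v (θ 0)) * dotp v (θ 1) * (dotp v (θ 2) - dotp v (θ' 2))
      + deriv φ (dotp v (θ 0)) * (dotp v (θ 1) - dotp v (θ' 1)) * dotp v (θ' 2)
      + (deriv φ (dotp v (θ 0)) - deriv φ (dotp v (θ' 0))) * dotp v (θ' 1) * dotp v (θ' 2)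
      - μ * (dotp (θ 1) (θ 2) / d - dotp (θ' 1) (θ' 2) / d) := by
      simp only [Y2, ← hμ]; ring
    have hp28 : (p : ℝ) ^ 2 ≤ (p : ℝ) ^ 8 := pow_le_pow_right₀ hp1 (by norm_num)
    have hp58 : (p : ℝ) ^ 5 ≤ (p : ℝ) ^ 8 := pow_le_pow_right₀ hp1 (by norm_num)
    rw [e]
    refine (abs_sub _ _).trans ((add_le_add_left (abs_add_three _ _ _) _).trans ?_)
    simp only [abs_mul]
    calc _ ≤ L * (p : ℝ) ^ 3 * ((p : ℝ) ^ 2 * r)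
          + L * ((p : ℝ) ^ 2 * r) * (p : ℝ) ^ 3
          + (L' * ((p : ℝ) ^ 2 * r)) * (p : ℝ) ^ 3 * (p : ℝ) ^ 3
          + |μ| * (2 * ((p : ℝ) ^ 2 * r)) := by
          gcongr
          · exact c1 1
          · exact c3 2
          · exact c3 1
          · exact c2 2
          · exact hl.trans (by gcongr; exact c3 0)
          · exact c2 1
          · exact c2 2
          · exact c4 1 2
      _ = L' * ((p : ℝ) ^ 8 * r) + 2 * L * ((p : ℝ) ^ 5 * r)
          + 2 * |μ| * ((p : ℝ) ^ 2 * r) := by ring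
      _ ≤ L' * ((p : ℝ) ^ 8 * r) + 2 * L * ((p : ℝ) ^ 8 * r)
          + 2 * |μ| * ((p : ℝ) ^ 8 * r) := by gcongr
      _ = _ := by ring

lemma eNorm_eq_of_sq {d : ℕ} {x : Fin d → ℝ} {r : ℝ} (h : dotp x x = r) :
    eNorm x = Real.sqrt r := by
  rw [← h]; unfold eNorm dotp; congr 1; exact Finset.sum_congr rfl fun i _ => by ring

lemma eNorm_nonneg' {d : ℕ} (x : Fin d → ℝ) : 0 ≤ eNorm x := Real.sqrt_nonneg _

lemma dotp_sub_self {d : ℕ} (x y : Fin d → ℝ) :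
    dotp (x - y) (x - y) = dotp x x - 2 * dotp x y + dotp y y := by
  rw [dotp_sub_right, dotp_comm (x - y) x, dotp_comm (x - y) y, dotp_sub_right, dotp_sub_right,
    dotp_comm y x]
  ring

/-- linear combinations of orthogonal sphere vectors -/
lemma dotp_comb {d : ℕ} {s w : Fin d → ℝ} (hs : dotp s s = d) (hw : dotp w w = d)
    (hsw : dotp s w = 0) (a b a' b' : ℝ) :
    dotp (a • s + b • w) (a' • s + b' • w) = (a * a' + b * b') * d := by
  rw [dotp_add_right, dotp_smul_right, dotp_smul_right, dotp_comm _ s, dotp_comm _ w,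
    dotp_add_right, dotp_add_right, dotp_smul_right, dotp_smul_right, dotp_smul_right,
    dotp_smul_right, dotp_comm w s, hs, hw, hsw]
  ring

lemma mvt_circle {φ : ℝ → ℝ} (hφd : Differentiable ℝ φ) {d p : ℕ}
    {V : Fin p → Fin d → ℝ} {ν κ : ℝ}
    (H2 : ∀ s w u : Fin d → ℝ, eNorm s = Real.sqrt d →
        eNorm w = Real.sqrt d → eNorm u = Real.sqrt d → dotp s w = 0 →
        |∑ k, deriv φ (dotp (V k) s) * dotp (V k) w * dotp (V k) u
          - ν * (dotp w u / d)| ≤ κ)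
    {s w u : Fin d → ℝ} (hs : eNorm s = Real.sqrt d) (hw : eNorm w = Real.sqrt d)
    (hu : eNorm u = Real.sqrt d) (hsw : dotp s w = 0) {θ : ℝ} (hθ : 0 ≤ θ) :
    |(∑ k, φ (dotp (V k) (Real.cos θ • s + Real.sin θ • w)) * dotp (V k) u
        - ν * (dotp (Real.cos θ • s + Real.sin θ • w) u / d))
      - (∑ k, φ (dotp (V k) s) * dotp (V k) u - ν * (dotp s u / d))| ≤ κ * θ := by
  let F : ℝ → ℝ := fun x => ∑ k, φ (Real.cos x * dotp (V k) s + Real.sin x * dotp (V k) w)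
      * dotp (V k) u - ν * ((Real.cos x * dotp u s + Real.sin x * dotp u w) / d)
  let F' : ℝ → ℝ := fun x => ∑ k, deriv φ (Real.cos x * dotp (V k) s + Real.sin x * dotp (V k) w)
      * (-Real.sin x * dotp (V k) s + Real.cos x * dotp (V k) w)
      * dotp (V k) u - ν * ((-Real.sin x * dotp u s + Real.cos x * dotp u w) / d)
  have hder : ∀ x, HasDerivAt F (F' x) x := by
    intro x
    have hin : ∀ a b : ℝ, HasDerivAt (fun x => Real.cos x * a + Real.sin x * b)
        (-Real.sin x * a + Real.cos x * b) x := fun a b =>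
      ((Real.hasDerivAt_cos x).mul_const a).add ((Real.hasDerivAt_sin x).mul_const b)
    refine HasDerivAt.sub ?_ (((hin _ _).div_const _).const_mul ν)
    refine HasDerivAt.fun_sum fun k _ => ?_
    exact ((hφd _).hasDerivAt.comp x (hin _ _)).mul_const _
  have hbd : ∀ x, ‖F' x‖ ≤ κ := by
    intro x
    have e1 : dotp s s = d := dotp_self_of_sph hs
    have e2 : dotp w w = d := dotp_self_of_sph hw
    have sc := Real.sin_sq_add_cos_sq x
    have := H2 (Real.cos x • s + Real.sin x • w) ((-Real.sin x) • s + Real.cos x • w) u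
      (eNorm_eq_of_sq (by rw [dotp_comb e1 e2 hsw]; nlinarith))
      (eNorm_eq_of_sq (by rw [dotp_comb e1 e2 hsw]; nlinarith)) hu
      (by rw [dotp_comb e1 e2 hsw]; ring)
    rw [dotp_comm _ u] at this
    simp only [dotp_add_right, dotp_smul_right] at this
    exact this
  have := Convex.norm_image_sub_le_of_norm_hasDerivWithin_le (f := F) (f' := F') (s := Set.univ)
    (x := 0) (y := θ) (C := κ) (fun x _ => (hder x).hasDerivWithinAt) (fun x _ => hbd x)
    convex_univ (Set.mem_univ _) (Set.mem_univ _)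
  rw [sub_zero, Real.norm_eq_abs, Real.norm_eq_abs, abs_of_nonneg hθ] at this
  simp only [F, Real.cos_zero, Real.sin_zero, one_mul, zero_mul, add_zero] at this
  rw [dotp_comm _ u, dotp_comm s u]
  simp only [dotp_add_right, dotp_smul_right]
  exact this

lemma incr {φ : ℝ → ℝ} (hφd : Differentiable ℝ φ) {d p : ℕ} (hd : 0 < d)
    {V : Fin p → Fin d → ℝ} {ν κ : ℝ} (hκ : 0 ≤ κ)
    (H2 : ∀ s w u : Fin d → ℝ, eNorm s = Real.sqrt d →
        eNorm w = Real.sqrt d → eNorm u = Real.sqrt d → dotp s w = 0 →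
        |∑ k, deriv φ (dotp (V k) s) * dotp (V k) w * dotp (V k) u
          - ν * (dotp w u / d)| ≤ κ)
    {s t u : Fin d → ℝ} (hs : eNorm s = Real.sqrt d) (ht : eNorm t = Real.sqrt d)
    (hu : eNorm u = Real.sqrt d) {δ : ℝ} (hδ0 : 0 < δ) (hδ : δ ≤ 1)
    (hst : dotp s t = d * (1 - δ ^ 2 / 2)) :
    |(∑ k, φ (dotp (V k) t) * dotp (V k) u - ∑ k, φ (dotp (V k) s) * dotp (V k) u)
      - ν * (dotp (t - s) u / d)| ≤ 2 * κ * δ := by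
  have hd' : (0 : ℝ) < d := by exact_mod_cast hd
  have e1 : dotp s s = d := dotp_self_of_sph hs
  have e2 : dotp t t = d := dotp_self_of_sph ht
  set θ := 2 * Real.arcsin (δ / 2) with hθ
  have hsin : Real.sin (Real.arcsin (δ / 2)) = δ / 2 :=
    Real.sin_arcsin (by linarith) (by linarith)
  have h0 : 0 ≤ Real.arcsin (δ / 2) := Real.arcsin_nonneg.2 (by linarith)
  have hle : Real.arcsin (δ / 2) ≤ Real.pi / 2 := Real.arcsin_le_pi_div_two _
  have hjordan := Real.mul_le_sin h0 hle
  rw [hsin] at hjordan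
  have hθδ : θ ≤ 2 * δ := by
    have hpi := Real.pi_pos
    have hpi4 := Real.pi_le_four
    rw [div_mul_eq_mul_div, div_le_iff₀ hpi] at hjordan
    nlinarith
  have hcos : Real.cos θ = 1 - δ ^ 2 / 2 := by
    rw [hθ, Real.cos_two_mul, Real.cos_sq', hsin]; ring
  have hsc := Real.sin_sq_add_cos_sq θ
  have hsinsq : Real.sin θ ^ 2 = δ ^ 2 * (1 - δ ^ 2 / 4) := by
    rw [hcos] at hsc; nlinarith
  have hsne : Real.sin θ ≠ 0 := by
    intro h
    rw [h] at hsinsq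
    have : 0 < δ ^ 2 * (1 - δ ^ 2 / 4) := by
      apply mul_pos (by positivity); nlinarith
    norm_num at hsinsq
    rcases hsinsq with h | h
    · linarith
    · nlinarith
  set w : Fin d → ℝ := (Real.sin θ)⁻¹ • (t - Real.cos θ • s) with hw
  have hsw : dotp s w = 0 := by
    rw [hw, dotp_smul_right, dotp_sub_right, dotp_smul_right, e1, hst, hcos]; ring
  have hww : dotp w w = d := by
    have : dotp (t - Real.cos θ • s) (t - Real.cos θ • s) = Real.sin θ ^ 2 * d := by
      rw [dotp_sub_self, dotp_smul_right, dotp_smul_right, dotp_comm (Real.cos θ • s) s,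
        dotp_smul_right, dotp_comm t s, e1, e2, hst, ← hcos]
      linear_combination (-(d : ℝ)) * hsc
    rw [hw, dotp_smul_right, dotp_comm, dotp_smul_right, this]
    field_simp
  have htw : Real.cos θ • s + Real.sin θ • w = t := by
    rw [hw, smul_smul, mul_inv_cancel₀ hsne, one_smul]; abel
  have := mvt_circle hφd H2 hs (eNorm_eq_of_sq hww) hu hsw (θ := θ) (by positivity)
  rw [htw] at this
  have e : dotp (t - s) u = dotp t u - dotp s u := by
    rw [dotp_comm, dotp_sub_right, dotp_comm u, dotp_comm u]
  rw [e]
  calc _ = _ := by congr 1; ring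
    _ ≤ κ * θ := this
    _ ≤ κ * (2 * δ) := by gcongr
    _ = _ := by ring

lemma coef_bound {φ : ℝ → ℝ} (hφd : Differentiable ℝ φ) {d p : ℕ} (hd : 0 < d)
    {V : Fin p → Fin d → ℝ} {ν κ : ℝ} (hκ : 0 < κ) (hκν : 16 * κ = |ν|)
    (H1 : ∀ s u : Fin d → ℝ, eNorm s = Real.sqrt d → eNorm u = Real.sqrt d →
        |∑ k, φ (dotp (V k) s) * dotp (V k) u - ν * (dotp s u / d)| ≤ κ)
    (H2 : ∀ s w u : Fin d → ℝ, eNorm s = Real.sqrt d →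
        eNorm w = Real.sqrt d → eNorm u = Real.sqrt d → dotp s w = 0 →
        |∑ k, deriv φ (dotp (V k) s) * dotp (V k) w * dotp (V k) u
          - ν * (dotp w u / d)| ≤ κ)
    {x y z : Fin d → ℝ} (hx : eNorm x = Real.sqrt d) (hy : eNorm y = Real.sqrt d)
    (hz : eNorm z = Real.sqrt d) {a₁ a₂ δ : ℝ} (hδdef : eNorm (z - y) / Real.sqrt d = δ)
    (hδ : δ ≤ 1 / 4)
    (heq : featureMap φ V x = fun k => a₁ * featureMap φ V y k + a₂ * featureMap φ V z k) :
    |a₂| * δ ≤ 4 ∧ |a₁ + a₂| ≤ 4 := by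
  have hd' : (0 : ℝ) < d := by exact_mod_cast hd
  have e1 : dotp y y = d := dotp_self_of_sph hy
  have e2 : dotp z z = d := dotp_self_of_sph hz
  have hδ0 : 0 ≤ δ := by rw [← hδdef]; exact div_nonneg (eNorm_nonneg' _) (Real.sqrt_nonneg _)
  have hnorm : dotp (z - y) (z - y) = d * δ ^ 2 := by
    rw [dotp_self_eq, ← hδdef, div_pow, Real.sq_sqrt hd'.le]; field_simp
  have hyz : dotp y z = d * (1 - δ ^ 2 / 2) := by
    rw [dotp_sub_self, e1, e2, dotp_comm z y] at hnorm; linarith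
  have hfe : ∀ u : Fin d → ℝ, ∑ k, φ (dotp (V k) x) * dotp (V k) u =
      (a₁ + a₂) * ∑ k, φ (dotp (V k) y) * dotp (V k) u +
      a₂ * (∑ k, φ (dotp (V k) z) * dotp (V k) u - ∑ k, φ (dotp (V k) y) * dotp (V k) u) := by
    intro u
    have : ∑ k, φ (dotp (V k) x) * dotp (V k) u =
        a₁ * ∑ k, φ (dotp (V k) y) * dotp (V k) u + a₂ * ∑ k, φ (dotp (V k) z) * dotp (V k) u := by
      rw [Finset.mul_sum, Finset.mul_sum, ← Finset.sum_add_distrib]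
      refine Finset.sum_congr rfl fun k _ => ?_
      have := congrFun heq k
      simp only [featureMap] at this
      rw [this]; ring
    rw [this]; ring
  have hX : ∀ u : Fin d → ℝ, eNorm u = Real.sqrt d →
      |∑ k, φ (dotp (V k) x) * dotp (V k) u| ≤ 17 * κ := by
    intro u hu
    have h1 := H1 x u hx hu
    have h2 : |ν * (dotp x u / d)| ≤ 16 * κ := by
      rw [abs_mul, hκν]
      have := dotp_cs hd hx hu
      nlinarith [abs_nonneg ν]
    rw [abs_le] at *
    constructor <;> linarith
  have hInc : ∀ u : Fin d → ℝ, eNorm u = Real.sqrt d →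
      |(∑ k, φ (dotp (V k) z) * dotp (V k) u - ∑ k, φ (dotp (V k) y) * dotp (V k) u)
      - ν * (dotp (z - y) u / d)| ≤ 2 * κ * δ := by
    intro u hu
    rcases hδ0.eq_or_lt with h | h
    · have hzy : z - y = 0 := by
        rw [← h] at hnorm
        have h3 : ∑ j, (z - y) j * (z - y) j = 0 := by
          have : dotp (z - y) (z - y) = 0 := by rw [hnorm]; ring
          exact this
        rw [Finset.sum_eq_zero_iff_of_nonneg (fun j _ => mul_self_nonneg _)] at h3
        funext j
        exact mul_self_eq_zero.1 (h3 j (Finset.mem_univ j))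
      have : z = y := sub_eq_zero.1 hzy
      rw [this, ← h]
      simp [dotp]
    · exact incr hφd hd hκ.le H2 hy hz hu h (by linarith) hyz
  set b := a₁ + a₂ with hb
  have A1 : |b| * (15 * κ) ≤ 17 * κ + (|a₂| * δ) * (4 * κ) := by
    have h1 := H1 y y hy hy
    have h2 := hInc y hy
    have h3 := hX y hy
    rw [hfe y] at h3
    have e3 : dotp (z - y) y / d = -(δ ^ 2 / 2) := by
      rw [dotp_comm, dotp_sub_right, hyz, e1]; field_simp; ring
    rw [e3] at h2
    rw [e1, div_self hd'.ne', mul_one] at h1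
    set P := ∑ k, φ (dotp (V k) y) * dotp (V k) y
    set Q := ∑ k, φ (dotp (V k) z) * dotp (V k) y - P
    have h4 : 15 * κ ≤ |P| := by
      have := abs_sub_abs_le_abs_sub ν P
      rw [abs_sub_comm ν P] at this
      linarith
    have h5 : |Q| ≤ δ * (4 * κ) := by
      have h6 : |ν * -(δ ^ 2 / 2)| ≤ δ * (2 * κ) := by
        rw [abs_mul, abs_neg, abs_of_nonneg (by positivity : 0 ≤ δ ^ 2 / 2), ← hκν]
        nlinarith [mul_nonneg hδ0 hκ.le]
      have := abs_sub_abs_le_abs_sub Q (ν * -(δ ^ 2 / 2))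
      nlinarith
    have h7 : |b| * |P| ≤ 17 * κ + |a₂| * |Q| := by
      rw [← abs_mul, ← abs_mul]
      have := abs_sub_abs_le_abs_sub (b * P) (-(a₂ * Q))
      rw [abs_neg, sub_neg_eq_add] at this
      linarith
    calc |b| * (15 * κ) ≤ |b| * |P| := by gcongr
      _ ≤ 17 * κ + |a₂| * |Q| := h7
      _ ≤ 17 * κ + |a₂| * (δ * (4 * κ)) := by gcongr
      _ = _ := by ring
  have A2 : (|a₂| * δ) * (14 * κ) ≤ 17 * κ + |b| * (3 * κ) := by
    rcases hδ0.eq_or_lt with h | h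
    · rw [← h]; simp; positivity
    set u : Fin d → ℝ := δ⁻¹ • (z - y) with hu
    have hus : eNorm u = Real.sqrt d := by
      apply eNorm_eq_of_sq
      rw [hu, dotp_smul_right, dotp_comm, dotp_smul_right, hnorm]; field_simp
    have h1 := H1 y u hy hus
    have h2 := hInc u hus
    have h3 := hX u hus
    rw [hfe u] at h3
    have e3 : dotp y u / d = -(δ / 2) := by
      rw [hu, dotp_smul_right, dotp_sub_right, hyz, e1]; field_simp; ring
    have e4 : dotp (z - y) u / d = δ := by
      rw [hu, dotp_smul_right, hnorm]; field_simp
    rw [e3] at h1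
    rw [e4] at h2
    set P := ∑ k, φ (dotp (V k) y) * dotp (V k) u
    set Q := ∑ k, φ (dotp (V k) z) * dotp (V k) u - P
    have h4 : |P| ≤ 3 * κ := by
      have h6 : |ν * -(δ / 2)| ≤ 2 * κ := by
        rw [abs_mul, abs_neg, abs_of_nonneg (by positivity : 0 ≤ δ / 2), ← hκν]
        nlinarith
      have := abs_sub_abs_le_abs_sub P (ν * -(δ / 2))
      linarith
    have h5 : δ * (14 * κ) ≤ |Q| := by
      have h6 : |ν * δ| = 16 * κ * δ := by rw [abs_mul, abs_of_pos h, ← hκν]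
      have := abs_sub_abs_le_abs_sub (ν * δ) Q
      rw [abs_sub_comm (ν * δ) Q] at this
      linarith
    have h7 : |a₂| * |Q| ≤ 17 * κ + |b| * |P| := by
      rw [← abs_mul, ← abs_mul]
      have := abs_sub_abs_le_abs_sub (a₂ * Q) (-(b * P))
      rw [abs_neg, sub_neg_eq_add, add_comm (a₂ * Q)] at this
      linarith
    calc (|a₂| * δ) * (14 * κ) = |a₂| * (δ * (14 * κ)) := by ring
      _ ≤ |a₂| * |Q| := by gcongr
      _ ≤ 17 * κ + |b| * |P| := h7
      _ ≤ 17 * κ + |b| * (3 * κ) := by gcongr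
  have A1' : |b| * 15 ≤ 17 + (|a₂| * δ) * 4 := by
    refine le_of_mul_le_mul_right ?_ hκ; linarith
  have A2' : (|a₂| * δ) * 14 ≤ 17 + |b| * 3 := by
    refine le_of_mul_le_mul_right ?_ hκ; linarith
  have := abs_nonneg b
  have : 0 ≤ |a₂| * δ := by positivity
  constructor <;> linarith

lemma num_basic {p : ℕ → ℕ}
    (hp : Tendsto (fun d : ℕ => (p d : ℝ) / ((d : ℝ) * (Real.log d) ^ 2)) atTop atTop)
    (A : ℝ) (hA : 0 ≤ A) : ∀ᶠ d : ℕ in atTop, 3 ≤ d ∧ 1 ≤ Real.log d ∧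
      A * (d * (Real.log d) ^ 2) ≤ p d := by
  filter_upwards [hp.eventually_ge_atTop A, eventually_ge_atTop 3] with d h1 h2
  have h3 : (3 : ℝ) ≤ d := by exact_mod_cast h2
  have h4 : 1 ≤ Real.log d := by
    rw [Real.le_log_iff_exp_le (by linarith)]
    have := Real.exp_one_lt_d9
    linarith
  refine ⟨h2, h4, ?_⟩
  rwa [le_div_iff₀ (by positivity)] at h1

lemma p_tendsto {p : ℕ → ℕ}
    (hp : Tendsto (fun d : ℕ => (p d : ℝ) / ((d : ℝ) * (Real.log d) ^ 2)) atTop atTop) :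
    (∀ᶠ d : ℕ in atTop, d ≤ p d) ∧ Tendsto (fun d => (p d : ℝ)) atTop atTop := by
  have h : ∀ᶠ d : ℕ in atTop, d ≤ p d := by
    filter_upwards [num_basic hp 1 zero_le_one] with d ⟨h1, h2, h3⟩
    have : (d : ℝ) ≤ p d := by
      have h4 : (1 : ℝ) ≤ (Real.log d) ^ 2 := one_le_pow₀ h2
      have h5 : (0 : ℝ) ≤ d := by positivity
      nlinarith
    exact_mod_cast this
  refine ⟨h, ?_⟩
  refine tendsto_atTop_mono' _ ?_ (tendsto_natCast_atTop_atTop (R := ℝ))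
  filter_upwards [h] with d hd
  exact_mod_cast hd

lemma num_small {p : ℕ → ℕ}
    (hp : Tendsto (fun d : ℕ => (p d : ℝ) / ((d : ℝ) * (Real.log d) ^ 2)) atTop atTop)
    {ε : ℝ} (hε : 0 < ε) : ∀ᶠ d : ℕ in atTop,
      d * Real.log (p d) ≤ ε * p d ∧ (Real.log d) ^ 2 ≤ ε * p d := by
  obtain ⟨hdp, ht⟩ := p_tendsto hp
  have hlog := ht.eventually ((isLittleO_log_rpow_atTop (r := 1 / 2) (by norm_num)).bound hε)
  filter_upwards [num_basic hp (2 / ε) (by positivity), hdp, hlog] with d ⟨h3, h1, hA⟩ hdp hl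
  have hd3 : (3 : ℝ) ≤ d := by exact_mod_cast h3
  have hdp' : (d : ℝ) ≤ p d := by exact_mod_cast hdp
  have hA' : 2 * (d * (Real.log d) ^ 2) ≤ ε * p d := by
    have := mul_le_mul_of_nonneg_left hA hε.le
    have e : ε * (2 / ε * (d * (Real.log d) ^ 2)) = 2 * (d * (Real.log d) ^ 2) := by field_simp
    linarith
  have hsq : 0 ≤ (Real.log d) ^ 2 := sq_nonneg _
  refine ⟨?_, by nlinarith⟩
  rcases le_total (p d : ℝ) ((d : ℝ) ^ 2) with h | h
  · have h5 : Real.log (p d) ≤ 2 * Real.log d := by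
      have := Real.log_le_log (by linarith) h
      rwa [Real.log_pow] at this
    have h6 : Real.log d ≤ Real.log d ^ 2 := by nlinarith
    calc d * Real.log (p d) ≤ d * (2 * Real.log d ^ 2) := by gcongr; linarith
      _ ≤ _ := by linarith
  · have h5 : (d : ℝ) ≤ Real.sqrt (p d) := Real.le_sqrt_of_sq_le h
    rw [← Real.sqrt_eq_rpow, Real.norm_eq_abs, Real.norm_eq_abs,
      abs_of_nonneg (Real.sqrt_nonneg _)] at hl
    have h6 := (le_abs_self _).trans hl
    have hs := Real.mul_self_sqrt (by positivity : (0 : ℝ) ≤ p d)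
    calc d * Real.log (p d) ≤ d * (ε * Real.sqrt (p d)) := by gcongr
      _ ≤ Real.sqrt (p d) * (ε * Real.sqrt (p d)) := by gcongr
      _ = ε * (Real.sqrt (p d) * Real.sqrt (p d)) := by ring
      _ = _ := by rw [hs]

lemma num_exp {p : ℕ → ℕ}
    (hp : Tendsto (fun d : ℕ => (p d : ℝ) / ((d : ℝ) * (Real.log d) ^ 2)) atTop atTop)
    {c : ℝ} (hc : 0 < c) : ∀ᶠ d : ℕ in atTop,
      (p d : ℝ) ^ (33 * d) * (2 * Real.exp (-(c * p d))) ≤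
        1 / 2 * Real.exp (-(Real.log d) ^ 2) := by
  obtain ⟨hdp, ht⟩ := p_tendsto hp
  filter_upwards [num_small hp (ε := c / 132) (by positivity), ht.eventually_ge_atTop (12 / c),
    ht.eventually_ge_atTop 1] with d ⟨h1, h2⟩ h3 h4
  have hpos : (0 : ℝ) < p d := by linarith
  have e : (p d : ℝ) ^ (33 * d) = Real.exp (33 * (d * Real.log (p d))) := by
    rw [← Real.rpow_natCast, Real.rpow_def_of_pos hpos]; congr 1; push_cast; ring
  have h5 : 12 ≤ c * p d := by rw [div_le_iff₀ hc] at h3; linarith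
  have h6 : (4 : ℝ) ≤ Real.exp 3 := by have := Real.add_one_le_exp 3; linarith
  have h7 : Real.exp (33 * (d * Real.log (p d))) * Real.exp (-(c * p d)) * Real.exp 3 ≤
      Real.exp (-(Real.log d) ^ 2) := by
    rw [← Real.exp_add, ← Real.exp_add]
    refine Real.exp_le_exp.2 ?_
    linarith
  rw [e]
  have h8 : 0 ≤ Real.exp (33 * (d * Real.log (p d))) * Real.exp (-(c * p d)) := by positivity
  nlinarith

lemma num_gauss {p : ℕ → ℕ}
    (hp : Tendsto (fun d : ℕ => (p d : ℝ) / ((d : ℝ) * (Real.log d) ^ 2)) atTop atTop)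
    {M : ℝ} (hM : 0 ≤ M) : ∀ᶠ d : ℕ in atTop,
      (p d : ℝ) * (d * (M * Real.exp (-((p d : ℝ) ^ 2 / 4)))) ≤ Real.exp (-(Real.log d) ^ 2) := by
  obtain ⟨hdp, ht⟩ := p_tendsto hp
  filter_upwards [num_small hp (ε := 1) (by positivity), ht.eventually_ge_atTop (16 * M + 16),
    hdp] with d ⟨h1, h2⟩ h3 h4
  have hdp' : (d : ℝ) ≤ p d := by exact_mod_cast h4
  set q : ℝ := (p d : ℝ)
  have hq : 0 < q := by linarith
  have e1 : q ≤ Real.exp q := by have := Real.add_one_le_exp q; linarith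
  have hM2 : M ≤ Real.exp q := by linarith
  have hmain : q * (d * M) ≤ Real.exp q * (Real.exp q * Real.exp q) := by
    gcongr; linarith
  have h5 : Real.exp q * (Real.exp q * Real.exp q) * Real.exp (-(q ^ 2 / 4)) ≤
      Real.exp (-(Real.log d) ^ 2) := by
    rw [← Real.exp_add, ← Real.exp_add, ← Real.exp_add]
    refine Real.exp_le_exp.2 ?_
    nlinarith
  calc q * (d * (M * Real.exp (-(q ^ 2 / 4)))) = q * (d * M) * Real.exp (-(q ^ 2 / 4)) := by ring
    _ ≤ Real.exp q * (Real.exp q * Real.exp q) * Real.exp (-(q ^ 2 / 4)) := by gcongr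
    _ ≤ _ := h5

/-- **Lemma A.10 (Boundedness of the coefficients in the duplication equation).**
Under the random features setup with `n = 2` and the data, activation, and scaling
assumptions: there are constants `c, C, ε₀ > 0` and `D` such that for all `d ≥ D`, with
probability at least `1 − 2 exp(−c log² d)` over `V` and `(x₁, x₂)`, simultaneously for all
`a₁, a₂, ε₁, ε₂` with `‖x₁+ε₁‖₂ = ‖x₁+ε₂‖₂ = √d`, `max(‖ε₁‖₂, ‖ε₂‖₂) ≤ ε₀ √d` and
`φ(x₂) = a₁ φ(x₁+ε₁) + a₂ φ(x₁+ε₂)`: `|a₂| δ ≤ C` and `|a₁ + a₂| ≤ C`. -/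
theorem coefficient_boundedness
    (φ : ℝ → ℝ) (hφ : ActivationAssumptionCore φ)
    (K : ℝ)
    (p : ℕ → ℕ)
    (P : (d : ℕ) → Measure (Fin d → ℝ))
    (hdata : ∀ d, DataAssumption (P d) K)
    (hp : Tendsto (fun d : ℕ => (p d : ℝ) / ((d : ℝ) * (Real.log d) ^ 2)) atTop atTop) :
    ∃ c : ℝ, 0 < c ∧ ∃ C : ℝ, 0 < C ∧ ∃ ε₀ : ℝ, 0 < ε₀ ∧ ∃ D : ℕ, ∀ d : ℕ, D ≤ d →
      1 - ENNReal.ofReal (2 * Real.exp (-c * (Real.log d) ^ 2)) ≤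
        ((gaussianMatrix (p d) d).prod (Measure.pi fun _ : Fin 2 => P d))
          {ω | ∀ a₁ a₂ : ℝ, ∀ ε₁ ε₂ : Fin d → ℝ,
            eNorm (ω.2 0 + ε₁) = Real.sqrt d → eNorm (ω.2 0 + ε₂) = Real.sqrt d →
            max (eNorm ε₁) (eNorm ε₂) ≤ ε₀ * Real.sqrt d →
            featureMap φ ω.1 (ω.2 1) =
              (fun k => a₁ * featureMap φ ω.1 (ω.2 0 + ε₁) k +
                a₂ * featureMap φ ω.1 (ω.2 0 + ε₂) k) →
            |a₂| * (eNorm (ε₂ - ε₁) / Real.sqrt d) ≤ C ∧ |a₁ + a₂| ≤ C} := by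
  obtain ⟨L, hL⟩ := hφ.lipschitz
  obtain ⟨L', hL'⟩ := hφ.deriv_lipschitz
  set μ := hermiteCoeff φ 1 with hμ
  have hμ0 : 0 < |μ| := abs_pos.2 hφ.mu1
  set η : ℝ := |μ| / 32 with hη
  have hη0 : 0 < η := by positivity
  have hB1 : 0 < |φ 0| + L + |μ| + 1 := by positivity
  have hB2 : 0 < L + |μ| + 1 := by positivity
  obtain ⟨hdp, ht⟩ := p_tendsto hp
  have hev := (((((num_exp hp (crate_pos hB1 hη0)).and (num_exp hp (crate_pos hB2 hη0))).and
    (num_gauss hp Mexp_nonneg)).and hdp).and (eventually_ge_atTop 3)).and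
    (ht.eventually_ge_atTop ((|φ 0| + L' + 2 * L + 2 * |μ|) / η))
  obtain ⟨D, hD⟩ := eventually_atTop.1 hev
  refine ⟨1, one_pos, 4, by norm_num, 1 / 8, by norm_num, D, fun d hdD => ?_⟩
  obtain ⟨⟨⟨⟨⟨hn1, hn2⟩, hn3⟩, hdp⟩, hd3⟩, hpC⟩ := hD d hdD
  have hd : 0 < d := by omega
  have hd' : (0 : ℝ) < d := by exact_mod_cast hd
  have hp0 : (0 : ℝ) < p d := by exact_mod_cast (by omega : 0 < p d)
  rw [div_le_iff₀ hη0] at hpC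
  have hL'0 : (0 : ℝ) ≤ L' := L'.2
  have hφ0 := abs_nonneg (φ 0)
  obtain ⟨E1, hE1, hE1'⟩ := event_base hφ hL hd hdp (by omega : 3 ≤ p d) hη0 (by linarith)
  obtain ⟨E2, hE2, hE2'⟩ := event_deriv hφ hL hL' hd hdp (by omega : 3 ≤ p d) hη0 (by linarith)
  have hE3 := coord_event (p := p d) hd
  set E3 : Set (Fin (p d) → Fin d → ℝ) := {V | ¬ ∀ k j, |V k j| ≤ p d} with hE3def
  have : IsProbabilityMeasure (P d) := (hdata d).prob
  have hE : (gaussianMatrix (p d) d) (E1 ∪ E2 ∪ E3) ≤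
      ENNReal.ofReal (2 * Real.exp (-1 * (Real.log d) ^ 2)) := by
    rw [← ofReal_measureReal]
    refine ENNReal.ofReal_le_ofReal ?_
    have h1 := measureReal_union_le (μ := gaussianMatrix (p d) d) (E1 ∪ E2) E3
    have h2 := measureReal_union_le (μ := gaussianMatrix (p d) d) E1 E2
    rw [← hμ] at hE1 hE2
    rw [neg_one_mul]
    linarith
  set N : Set (Fin 2 → Fin d → ℝ) := {x | ¬ ∀ i, eNorm (x i) = Real.sqrt d} with hN
  have hN0 : (Measure.pi fun _ : Fin 2 => P d) N = 0 := by
    have : ∀ᵐ x ∂(Measure.pi fun _ : Fin 2 => P d), ∀ i, eNorm (x i) = Real.sqrt d := by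
      rw [ae_all_iff]
      intro i
      exact (Measure.quasiMeasurePreserving_eval (fun _ : Fin 2 => P d) i).ae (hdata d).norm_eq
    exact ae_iff.1 this
  set S : Set ((Fin (p d) → Fin d → ℝ) × (Fin 2 → Fin d → ℝ)) := {ω | ∀ a₁ a₂ : ℝ,
          ∀ ε₁ ε₂ : Fin d → ℝ,
            eNorm (ω.2 0 + ε₁) = Real.sqrt d → eNorm (ω.2 0 + ε₂) = Real.sqrt d →
            max (eNorm ε₁) (eNorm ε₂) ≤ 1 / 8 * Real.sqrt d →
            featureMap φ ω.1 (ω.2 1) =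
              (fun k => a₁ * featureMap φ ω.1 (ω.2 0 + ε₁) k +
                a₂ * featureMap φ ω.1 (ω.2 0 + ε₂) k) →
            |a₂| * (eNorm (ε₂ - ε₁) / Real.sqrt d) ≤ 4 ∧ |a₁ + a₂| ≤ 4} with hS
  have hsub : Sᶜ ⊆ ((E1 ∪ E2 ∪ E3) ×ˢ Set.univ) ∪ (Set.univ ×ˢ N) := by
    rintro ⟨V, x⟩ hω
    by_contra hcon
    apply hω
    have hV : V ∉ E1 ∪ E2 ∪ E3 := fun h => hcon (Or.inl ⟨h, trivial⟩)
    have hx : ∀ i, eNorm (x i) = Real.sqrt d := by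
      by_contra h
      exact hcon (Or.inr ⟨trivial, h⟩)
    have hV1 : V ∉ E1 := fun h => hV (Or.inl (Or.inl h))
    have hV2 : V ∉ E2 := fun h => hV (Or.inl (Or.inr h))
    have hV3 : ∀ k j, |V k j| ≤ p d := by
      by_contra h
      exact hV (Or.inr h)
    intro a₁ a₂ ε₁ ε₂ h1 h2 hmax heq
    have hsub : (x 0 + ε₂) - (x 0 + ε₁) = ε₂ - ε₁ := by abel
    have hκ : 16 * (2 * (p d * η)) = |(p d : ℝ) * μ| := by
      rw [abs_mul, abs_of_pos hp0, hη]; ring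
    refine coef_bound (x := x 1) (y := x 0 + ε₁) (z := x 0 + ε₂) hφ.differentiable hd
      (κ := 2 * (p d * η)) (ν := p d * μ) (by positivity) hκ
      (fun s u hs hu => ?_) (fun s w u hs hw hu hsw => ?_) (hx 1) h1 h2
      (by rw [hsub]) ?_ heq
    · rw [mul_assoc]; exact hE1' V hV1 hV3 s u hs hu
    · rw [mul_assoc]; exact hE2' V hV2 hV3 s w u hs hw hu hsw
    · have hs0 : 0 < Real.sqrt d := Real.sqrt_pos.2 hd'
      rw [div_le_iff₀ hs0]
      have m1 := (le_max_left _ _).trans hmax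
      have m2 := (le_max_right _ _).trans hmax
      have b0 := eNorm_nonneg' ε₁
      have b1 := eNorm_nonneg' ε₂
      have hle : eNorm (ε₂ - ε₁) ^ 2 ≤ 2 * eNorm ε₂ ^ 2 + 2 * eNorm ε₁ ^ 2 := by
        rw [← dotp_self_eq, ← dotp_self_eq, ← dotp_self_eq, dotp_sub_self]
        have h5 : 0 ≤ dotp (ε₂ + ε₁) (ε₂ + ε₁) := by rw [dotp_self_eq]; positivity
        rw [dotp_add_right, dotp_comm (ε₂ + ε₁) ε₂, dotp_comm (ε₂ + ε₁) ε₁, dotp_add_right,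
          dotp_add_right, dotp_comm ε₁ ε₂] at h5
        linarith
      refine abs_le_of_sq_le_sq' ?_ (by positivity) |>.2
      nlinarith
  have hcompl : ((gaussianMatrix (p d) d).prod (Measure.pi fun _ : Fin 2 => P d)) Sᶜ ≤
      ENNReal.ofReal (2 * Real.exp (-1 * (Real.log d) ^ 2)) := by
    refine (measure_mono hsub).trans ((measure_union_le _ _).trans ?_)
    rw [Measure.prod_prod, Measure.prod_prod, hN0, measure_univ, mul_one, mul_zero, add_zero]
    exact hE
  rw [tsub_le_iff_right]
  calc (1 : ENNReal) = ((gaussianMatrix (p d) d).prod (Measure.pi fun _ : Fin 2 => P d))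
        (S ∪ Sᶜ) := by rw [Set.union_compl_self, measure_univ]
    _ ≤ _ := measure_union_le _ _
    _ ≤ _ := by gcongr
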